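/- Let Δ be a pure simplicial complex with dim Δ = d − 1 and let 2 ≤ s ≤ d. Then S_2-depth(S/I_Δ^(2)) ≥ s if and only if diam((link_Δ F)^(1)) ≤ 2 for every face F ∈ Δ with dim link_Δ F ≥ d − s + 1. -/

import Mathlib

/-!
Common definitions for formalizing "The Serre depth of Stanley–Reisner rings and
the depth of their symbolic powers" (Muta–Terai).
-/

open CategoryTheory MvPolynomial

noncomputable section

namespace SerrePaper

/-! ### Simplicial complexes (given by their sets of faces) -/

variable {V : Type}

/-- A (nonempty, downward closed) abstract simplicial complex, given by its set of faces. -/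
def IsComplex (K : Set (Finset V)) : Prop :=
  K.Nonempty ∧ ∀ F ∈ K, ∀ G ⊆ F, G ∈ K

/-- `F` is a facet (maximal face) of `K`. -/
def IsFacet (K : Set (Finset V)) (F : Finset V) : Prop :=
  F ∈ K ∧ ∀ G ∈ K, F ⊆ G → G = F

/-- `K` is pure: all facets have the same cardinality. -/
def Pure (K : Set (Finset V)) : Prop :=
  ∀ F G : Finset V, IsFacet K F → IsFacet K G → F.card = G.card

/-- `dim K = d - 1`, i.e. the maximal cardinality of a face of `K` is `d`. -/
def HasDimCard (K : Set (Finset V)) (d : ℕ) : Prop :=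
  (∃ F ∈ K, F.card = d) ∧ ∀ F ∈ K, F.card ≤ d

/-- the link of the face `F` in `K`. -/
def link [DecidableEq V] (K : Set (Finset V)) (F : Finset V) : Set (Finset V) :=
  { G | G ∪ F ∈ K ∧ G ∩ F = ∅ }

/-- `skeleton K t` is the `(t-1)`-skeleton `K^{t-1}` of `K`:
all faces with at most `t` vertices. -/
def skeleton (K : Set (Finset V)) (t : ℕ) : Set (Finset V) :=
  { F ∈ K | F.card ≤ t }

/-- The Alexander dual complex `K^∨ = { F | complement of F is not a face of K }`. -/
def dualComplex [Fintype V] [DecidableEq V] (K : Set (Finset V)) : Set (Finset V) :=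
  { F | Fᶜ ∉ K }

/-- The copy of `K` on its own vertex set (as a complex on the corresponding subtype). -/
def restrictVerts (K : Set (Finset V)) : Set (Finset {v : V // {v} ∈ K}) :=
  { F | F.map (Function.Embedding.subtype _) ∈ K }

/-- The induced subcomplex `K_W` on a subset `W` of the vertices. -/
def inducedSub (K : Set (Finset V)) (W : Finset V) : Set (Finset V) :=
  { F ∈ K | F ⊆ W }

/-- `K` is a matroid complex: every induced subcomplex is pure. -/
def IsMatroidComplex (K : Set (Finset V)) : Prop :=
  ∀ W : Finset V, Pure (inducedSub K W)

/-! ### Reduced simplicial homology with coefficients in a field `k` -/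

/-- The group of simplicial `(c-1)`-chains: formal `k`-linear combinations of the
faces of `K` with exactly `c` vertices. -/
abbrev chainGroup (k : Type) [Field k] (K : Set (Finset V)) (c : ℕ) : Type :=
  {F : Finset V // F ∈ K ∧ F.card = c} →₀ k

open Classical in
/-- the boundary of a single face, `∂F = ∑_{x ∈ F} (-1)^{pos of x in F} (F \ {x})`. -/
def boundaryAt (k : Type) [Field k] [LinearOrder V] (K : Set (Finset V)) (c : ℕ)
    (F : {F : Finset V // F ∈ K ∧ F.card = c + 1}) : chainGroup k K c :=
  ∑ x ∈ F.1.attach,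
    if h : F.1.erase x.1 ∈ K then
      Finsupp.single
        ⟨F.1.erase x.1, h, by simp [Finset.card_erase_of_mem x.2, F.2.2]⟩
        ((-1 : k) ^ (F.1.filter (fun y => y < x.1)).card)
    else 0

/-- The simplicial boundary map (for a downward closed `K` this is the usual
boundary map of the reduced (augmented) chain complex of `K`, where faces with
`c` vertices sit in homological degree `c - 1`). -/
def boundary (k : Type) [Field k] [LinearOrder V] (K : Set (Finset V)) (c : ℕ) :
    chainGroup k K (c + 1) →ₗ[k] chainGroup k K c :=
  Finsupp.lsum k fun F => LinearMap.toSpanSingleton k _ (boundaryAt k K c F)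

/-- `H̃ᵢ(K; k) = 0`: every reduced `i`-cycle is a boundary.  (For `i ≤ -2` this holds
trivially; for `i = -1` the relevant cycle group is the whole of the `(-1)`-chains.) -/
def reducedHomologyVanishes (k : Type) [Field k] [LinearOrder V]
    (K : Set (Finset V)) (i : ℤ) : Prop :=
  if i < -1 then True
  else if i = -1 then
    ∀ z : chainGroup k K 0, ∃ b : chainGroup k K 1, boundary k K 0 b = z
  else
    ∀ z : chainGroup k K (i.toNat + 1), boundary k K i.toNat z = 0 →
      ∃ b : chainGroup k K (i.toNat + 2), boundary k K (i.toNat + 1) b = z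

/-- Nonvanishing `β_{i,j}(k[K]) ≠ 0` of the graded Betti numbers of the
Stanley–Reisner ring of `K`, expressed via Hochster's formula:
`β_{i,j}(k[K]) = ∑_{W ⊆ V, |W| = j} dim_k H̃_{j-i-1}(K_W; k)`. -/
def bettiNonzero (k : Type) [Field k] [LinearOrder V] (K : Set (Finset V)) (i j : ℕ) : Prop :=
  ∃ W : Finset V, W.card = j ∧
    ¬ reducedHomologyVanishes k (inducedSub K W) ((j : ℤ) - i - 1)

/-- `reg_{≤ r} I_K = max{ j : β_{i,i+j}(I_K) ≠ 0 for some i ≤ r }`, where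
`β_{i,d}(I_K) = β_{i+1,d}(k[K])`. -/
def regLEIdeal (k : Type) [Field k] [LinearOrder V] (K : Set (Finset V)) (r : ℕ) : ℕ :=
  sSup { j : ℕ | ∃ i ≤ r, bettiNonzero k K (i + 1) (i + j) }

/-- `indeg I_K`: the least degree of a minimal generator of the Stanley–Reisner
ideal of `K`, i.e. `min{ j : β_{0,j}(I_K) = β_{1,j}(k[K]) ≠ 0 }`. -/
def indegIdeal (k : Type) [Field k] [LinearOrder V] (K : Set (Finset V)) : ℕ :=
  sInf { j : ℕ | bettiNonzero k K 1 j }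

/-! ### Stanley–Reisner rings, Serre depth, depth, symbolic powers -/

variable (k : Type) [Field k]

/-- The Stanley–Reisner ideal of `K` (generated by the monomials of the non-faces,
equivalently by those of the minimal non-faces). -/
def srIdeal (K : Set (Finset V)) : Ideal (MvPolynomial V k) :=
  Ideal.span { m | ∃ F : Finset V, F ∉ K ∧ m = ∏ i ∈ F, X i }

/-- The homogeneous maximal ideal `(x_v : v ∈ V)` of the polynomial ring. -/
def maxIdeal (V : Type) : Ideal (MvPolynomial V k) :=
  Ideal.span (Set.range X)

/-- The quotient ring `S/I` as an object of `ModuleCat S`. -/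
def quotMod {V : Type} (I : Ideal (MvPolynomial V k)) : ModuleCat (MvPolynomial V k) :=
  ModuleCat.of _ (MvPolynomial V k ⧸ I)

/-- The Stanley–Reisner ring `k[K] = S/I_K` as a module over `S`. -/
def srRing (K : Set (Finset V)) : ModuleCat (MvPolynomial V k) :=
  quotMod k (srIdeal k K)

/-- The Krull dimension of a module, `dim M = dim (R / ann M)` (so `dim 0 = ⊥ = -∞`). -/
def modDim {R : Type} [CommRing R] (M : ModuleCat R) : WithBot ℕ∞ :=
  ringKrullDim (R ⧸ Module.annihilator R M)

/-- `Ext_R^i(M, N)` as an `R`-module. -/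
def extM {R : Type} [CommRing R] (M N : ModuleCat R) (i : ℕ) : ModuleCat R :=
  ((Ext R (ModuleCat R) i).obj (Opposite.op M)).obj N

/-- `K_M^j = Ext_S^{n-j}(M, ω_S)`, the (Matlis dual of) local cohomology; since the
canonical module `ω_S` of the polynomial ring `S` is `S` itself up to a
grading shift, we use `Ext_S^{n-j}(M, S)`. -/
def serreK {V : Type} (M : ModuleCat (MvPolynomial V k)) (j : ℕ) :
    ModuleCat (MvPolynomial V k) :=
  extM M (ModuleCat.of _ (MvPolynomial V k)) (Nat.card V - j)

/-- The Serre depth `S_r-depth(M) = min{ j : dim K_M^j ≥ j - r + 1 }`.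
(Note that, since `dim K_M^j` is either `⊥` or `≥ 0`, the inequality
`dim K_M^j ≥ j - r + 1` of (possibly negative) integers is equivalent to
`(j + 1 - r : ℕ) ≤ dim K_M^j` with truncated subtraction.) -/
def serreDepth {V : Type} (r : ℕ) (M : ModuleCat (MvPolynomial V k)) : ℕ :=
  sInf { j : ℕ | ((j + 1 - r : ℕ) : WithBot ℕ∞) ≤ modDim (serreK k M j) }

/-- Serre's condition `(S_r)` for an unmixed module: `S_r-depth(M) = dim M`. -/
def serreCond {V : Type} (r : ℕ) (M : ModuleCat (MvPolynomial V k)) : Prop :=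
  (serreDepth k r M : WithBot ℕ∞) = modDim M

/-- The depth of `M` with respect to the homogeneous maximal ideal,
via Rees' characterization `depth M = min{ i : Ext^i(S/m, M) ≠ 0 }`. -/
def mdepth {V : Type} (M : ModuleCat (MvPolynomial V k)) : ℕ :=
  sInf { i : ℕ | Nontrivial (extM (quotMod k (maxIdeal k V)) M i) }

/-- `M` is Cohen–Macaulay: `depth M = dim M`. -/
def isCM {V : Type} (M : ModuleCat (MvPolynomial V k)) : Prop :=
  (mdepth k M : WithBot ℕ∞) = modDim M

/-- The `ℓ`-th symbolic power of a (radical, e.g. squarefree monomial) ideal: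
`I^(ℓ) = ⋂_{P ∈ Min(I)} P^ℓ`. -/
def symbPow {R : Type} [CommRing R] (I : Ideal R) (ℓ : ℕ) : Ideal R :=
  sInf { J | ∃ P ∈ I.minimalPrimes, J = P ^ ℓ }

/-- The height of an ideal: the Krull dimension of the poset of primes contained in it. -/
def idealHeight {R : Type} [CommRing R] (p : Ideal R) : WithBot ℕ∞ :=
  Order.krullDim { q : PrimeSpectrum R // q.asIdeal ≤ p }

/-- `R/I` is unmixed: all associated primes of `R/I` have the same height. -/
def IsUnmixedIdeal {R : Type} [CommRing R] (I : Ideal R) : Prop :=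
  ∀ p q : Ideal R, p ∈ associatedPrimes R (R ⧸ I) → q ∈ associatedPrimes R (R ⧸ I) →
    idealHeight p = idealHeight q

/-- Nonvanishing of the first local cohomology `H_m^1(S/I) ≠ 0`. -/
def H1NE {V : Type} (I : Ideal (MvPolynomial V k)) : Prop :=
  Nontrivial ((localCohomology (maxIdeal k V) 1).obj (quotMod k I))

/-- `I` is a squarefree monomial ideal. -/
def IsSqFreeMonomialIdeal {V : Type} (I : Ideal (MvPolynomial V k)) : Prop :=
  ∃ G : Set (Finset V), I = Ideal.span ((fun F => ∏ i ∈ F, X i) '' G)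

end SerrePaper

end
namespace SerrePaper

/-- The 1-skeleton of `K` (viewed as a graph on the vertices of `K`) has diameter at
most 2: any two vertices are equal, adjacent, or have a common neighbour. -/
def diamLE2 {V : Type} [DecidableEq V] (K : Set (Finset V)) : Prop :=
  ∀ u w : V, {u} ∈ K → {w} ∈ K →
    u = w ∨ ({u, w} : Finset V) ∈ K ∨ ∃ z : V, ({u, z} : Finset V) ∈ K ∧ ({z, w} : Finset V) ∈ K

section Homological

open CategoryTheory.Abelian

variable {R : Type} [CommRing R]

/-- `Ext_R^i(M, R)`, as an `R`-module defined through the derived category. -/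
abbrev ExtSelf (R : Type) [CommRing R] (M : Type) [AddCommGroup M] [Module R M] (i : ℕ) : Type :=
  Abelian.Ext (ModuleCat.of R M) (ModuleCat.of R R) i

section Sequences

variable {A B C : Type} [AddCommGroup A] [AddCommGroup B] [AddCommGroup C]
  [Module R A] [Module R B] [Module R C]

/-- Pullback of `Ext_R^i(-, R)` along a linear map. -/
noncomputable def extPull (f : A →ₗ[R] B) (i : ℕ) (x : ExtSelf R B i) : ExtSelf R A i :=
  (Ext.mk₀ (ModuleCat.ofHom f)).comp x (zero_add i)

theorem extPull_smul (f : A →ₗ[R] B) (i : ℕ) (r : R) (x : ExtSelf R B i) :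
    extPull f i (r • x) = r • extPull f i x :=
  Ext.comp_smul ..

theorem extPull_comp (f : A →ₗ[R] B) (g : B →ₗ[R] C) (i : ℕ) (x : ExtSelf R C i) :
    extPull (g ∘ₗ f) i x = extPull f i (extPull g i x) := by
  simp only [extPull, Ext.mk₀_comp_mk₀_assoc]
  rfl

theorem extPull_smul_id (r : R) (i : ℕ) (x : ExtSelf R A i) :
    extPull (r • LinearMap.id) i x = r • x := by
  have : ModuleCat.ofHom (r • LinearMap.id : A →ₗ[R] A) = r • 𝟙 (ModuleCat.of R A) := by
    ext; rfl
  rw [extPull, this, Ext.mk₀_smul, Ext.smul_comp, Ext.mk₀_id_comp]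

theorem extPull_id (i : ℕ) (x : ExtSelf R A i) : extPull LinearMap.id i x = x := by
  have := extPull_smul_id (A := A) (1 : R) i x
  rwa [one_smul, one_smul] at this

theorem extSelf_subsingleton_of_equiv (e : A ≃ₗ[R] B) {i : ℕ}
    (h : Subsingleton (ExtSelf R B i)) : Subsingleton (ExtSelf R A i) := by
  refine subsingleton_of_forall_eq 0 fun x => ?_
  have hx := extPull_comp e.toLinearMap e.symm.toLinearMap i x
  rw [Subsingleton.elim (extPull e.symm.toLinearMap i x) ((0 : R) • 0), extPull_smul,
    zero_smul] at hx
  rw [← hx, show e.symm.toLinearMap ∘ₗ e.toLinearMap = LinearMap.id by ext; simp, extPull_id]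

/-- The short exact sequence of module categories attached to linear maps. -/
theorem shortExact_of_linearMap (f : A →ₗ[R] B) (g : B →ₗ[R] C) (hf : Function.Injective f)
    (hg : Function.Surjective g) (hfg : Function.Exact f g) :
    (ShortComplex.mk (ModuleCat.ofHom f) (ModuleCat.ofHom g)
      (by ext x; exact hfg.apply_apply_eq_zero x)).ShortExact where
  exact := (ShortComplex.ShortExact.moduleCat_exact_iff_function_exact _).2 hfg
  mono_f := (ModuleCat.mono_iff_injective _).2 hf
  epi_g := (ModuleCat.epi_iff_surjective _).2 hg

theorem extPull_exact (f : A →ₗ[R] B) (g : B →ₗ[R] C) (hf : Function.Injective f)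
    (hg : Function.Surjective g) (hfg : Function.Exact f g) (i : ℕ) (x : ExtSelf R B i)
    (hx : extPull f i x = 0) : ∃ y, extPull g i y = x :=
  Ext.contravariant_sequence_exact₂ (shortExact_of_linearMap f g hf hg hfg) _ x hx

/-- The connecting map of the long exact sequence of `Ext_R(-, R)`. -/
theorem exists_connecting (f : A →ₗ[R] B) (g : B →ₗ[R] C) (hf : Function.Injective f)
    (hg : Function.Surjective g) (hfg : Function.Exact f g) (i : ℕ) :
    ∃ δ : ExtSelf R A i →ₗ[R] ExtSelf R C (i + 1),
      (∀ x, δ x = 0 ↔ ∃ y, extPull f i y = x) ∧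
      ∀ x, extPull g (i + 1) x = 0 ↔ ∃ y, δ y = x := by
  have hS := shortExact_of_linearMap f g hf hg hfg
  refine ⟨Ext.bilinearCompOfLinear R _ _ _ 1 i (i + 1) (add_comm 1 i) hS.extClass,
    fun x => ⟨fun hx => Ext.contravariant_sequence_exact₁ hS _ x (add_comm 1 i) hx, ?_⟩,
    fun x => ⟨fun hx => Ext.contravariant_sequence_exact₃ hS _ x hx (add_comm 1 i), ?_⟩⟩
  · rintro ⟨y, rfl⟩
    exact hS.extClass_comp_assoc y (h := add_comm 1 i)
  · rintro ⟨y, rfl⟩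
    exact hS.comp_extClass_assoc y (h := add_comm 1 i)

theorem extSelf_subsingleton_middle (f : A →ₗ[R] B) (g : B →ₗ[R] C) (hf : Function.Injective f)
    (hg : Function.Surjective g) (hfg : Function.Exact f g) {i : ℕ}
    (hA : Subsingleton (ExtSelf R A i)) (hC : Subsingleton (ExtSelf R C i)) :
    Subsingleton (ExtSelf R B i) := by
  refine subsingleton_of_forall_eq 0 fun x => ?_
  obtain ⟨y, rfl⟩ := extPull_exact f g hf hg hfg i x (Subsingleton.elim _ _)
  rw [Subsingleton.elim y ((0 : R) • 0), extPull_smul, zero_smul]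

theorem extSelf_subsingleton_left (f : A →ₗ[R] B) (g : B →ₗ[R] C) (hf : Function.Injective f)
    (hg : Function.Surjective g) (hfg : Function.Exact f g) {i : ℕ}
    (hB : Subsingleton (ExtSelf R B i)) (hC : Subsingleton (ExtSelf R C (i + 1))) :
    Subsingleton (ExtSelf R A i) := by
  obtain ⟨δ, h, -⟩ := exists_connecting f g hf hg hfg i
  refine subsingleton_of_forall_eq 0 fun x => ?_
  obtain ⟨y, rfl⟩ := (h x).1 (Subsingleton.elim _ _)
  rw [Subsingleton.elim y ((0 : R) • 0), extPull_smul, zero_smul]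

theorem extSelf_subsingleton_right (f : A →ₗ[R] B) (g : B →ₗ[R] C) (hf : Function.Injective f)
    (hg : Function.Surjective g) (hfg : Function.Exact f g) {i : ℕ}
    (hA : Subsingleton (ExtSelf R A i)) (hB : Subsingleton (ExtSelf R B (i + 1))) :
    Subsingleton (ExtSelf R C (i + 1)) := by
  obtain ⟨δ, -, h⟩ := exists_connecting f g hf hg hfg i
  refine subsingleton_of_forall_eq 0 fun x => ?_
  obtain ⟨y, rfl⟩ := (h x).1 (Subsingleton.elim _ _)
  rw [Subsingleton.elim y 0, map_zero]

theorem annihilator_extSelf_le_left (f : A →ₗ[R] B) (g : B →ₗ[R] C) (hf : Function.Injective f)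
    (hg : Function.Surjective g) (hfg : Function.Exact f g) {i : ℕ}
    (hC : Subsingleton (ExtSelf R C (i + 1))) :
    Module.annihilator R (ExtSelf R B i) ≤ Module.annihilator R (ExtSelf R A i) := by
  obtain ⟨δ, h, -⟩ := exists_connecting f g hf hg hfg i
  intro r hr
  rw [Module.mem_annihilator] at hr ⊢
  intro x
  obtain ⟨y, rfl⟩ := (h x).1 (Subsingleton.elim _ _)
  rw [← extPull_smul, hr, ← zero_smul R (0 : ExtSelf R B i), extPull_smul, zero_smul]

theorem annihilator_extSelf_le_right (f : A →ₗ[R] B) (g : B →ₗ[R] C)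
    (hf : Function.Injective f) (hg : Function.Surjective g) (hfg : Function.Exact f g) {i : ℕ}
    (hB : Subsingleton (ExtSelf R B (i + 1))) :
    Module.annihilator R (ExtSelf R A i) ≤ Module.annihilator R (ExtSelf R C (i + 1)) := by
  obtain ⟨δ, -, h⟩ := exists_connecting f g hf hg hfg i
  intro r hr
  rw [Module.mem_annihilator] at hr ⊢
  intro x
  obtain ⟨y, rfl⟩ := (h x).1 (Subsingleton.elim _ _)
  rw [← map_smul, hr, map_zero]

theorem mem_annihilator_extSelf_of_factor (f : A →ₗ[R] B) (g : B →ₗ[R] A) (r : R)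
    (h : g ∘ₗ f = r • LinearMap.id) {i : ℕ} (hB : Subsingleton (ExtSelf R B i)) :
    r ∈ Module.annihilator R (ExtSelf R A i) := by
  rw [Module.mem_annihilator]
  intro x
  rw [← extPull_smul_id, ← h, extPull_comp, Subsingleton.elim (extPull g i x) ((0 : R) • 0),
    extPull_smul, zero_smul]

theorem mul_mem_annihilator_extSelf_of_factor (f : A →ₗ[R] B) (g : B →ₗ[R] A) (r : R)
    (h : g ∘ₗ f = r • LinearMap.id) {i : ℕ} {a : R}
    (ha : a ∈ Module.annihilator R (ExtSelf R B i)) :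
    a * r ∈ Module.annihilator R (ExtSelf R A i) := by
  rw [Module.mem_annihilator] at ha ⊢
  intro x
  rw [mul_smul, ← extPull_smul_id r i x, ← h, extPull_comp, ← extPull_smul, ha,
    ← zero_smul R (0 : ExtSelf R B i), extPull_smul, zero_smul]

theorem extSelf_subsingleton_of_subsingleton [Subsingleton A] (i : ℕ) :
    Subsingleton (ExtSelf R A i) := by
  refine subsingleton_of_forall_eq 0 fun x => ?_
  rw [← one_smul R x, ← zero_smul R x, ← extPull_smul_id, ← extPull_smul_id]
  congr 1
  ext a
  exact Subsingleton.elim _ _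

theorem extSelf_subsingleton_pi {τ : Type} [Fintype τ] (M : τ → Type)
    [∀ t, AddCommGroup (M t)] [∀ t, Module R (M t)] {i : ℕ}
    (h : ∀ t, Subsingleton (ExtSelf R (M t) i)) : Subsingleton (ExtSelf R (∀ t, M t) i) := by
  classical
  refine subsingleton_of_forall_eq 0 fun x => ?_
  have key : (LinearMap.id : (∀ t, M t) →ₗ[R] _) =
      ∑ t, LinearMap.single R M t ∘ₗ LinearMap.proj t := by
    ext t m s
    simp [Finset.sum_apply]
  have hsum : ModuleCat.ofHom (∑ t, LinearMap.single R M t ∘ₗ LinearMap.proj t) =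
      ∑ t, ModuleCat.ofHom (LinearMap.single R M t ∘ₗ LinearMap.proj t) :=
    map_sum (ModuleCat.homAddEquiv (M := ModuleCat.of R (∀ t, M t))
      (N := ModuleCat.of R (∀ t, M t))).symm _ _
  have hx : ∀ t, (Ext.mk₀ (ModuleCat.ofHom
      (LinearMap.single R M t ∘ₗ LinearMap.proj t))).comp x (zero_add i) = 0 := by
    intro t
    change extPull _ i x = 0
    rw [extPull_comp, Subsingleton.elim (extPull (LinearMap.single R M t) i x) ((0 : R) • 0),
      extPull_smul, zero_smul]
  rw [← extPull_id i x, key, extPull, hsum, Ext.mk₀_sum, Ext.sum_comp]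
  exact Finset.sum_eq_zero fun t _ => hx t

end Sequences

section Quotients

variable {A B C : Type} [AddCommGroup A] [AddCommGroup B] [AddCommGroup C]
  [Module R A] [Module R B] [Module R C]

/-- A presentation of a short exact sequence `0 → A/W₁ → B/W₂ → C/W₃ → 0`. -/
structure QuotExact (φ : A →ₗ[R] B) (ψ : B →ₗ[R] C) (W₁ : Submodule R A) (W₂ : Submodule R B)
    (W₃ : Submodule R C) : Prop where
  surj : Function.Surjective ψ
  mem_left : ∀ a, a ∈ W₁ ↔ φ a ∈ W₂
  mem_right : ∀ b, ψ b ∈ W₃ ↔ ∃ a, b - φ a ∈ W₂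

variable {φ : A →ₗ[R] B} {ψ : B →ₗ[R] C} {W₁ : Submodule R A} {W₂ : Submodule R B}
  {W₃ : Submodule R C}

theorem QuotExact.le_left (h : QuotExact φ ψ W₁ W₂ W₃) : W₁ ≤ W₂.comap φ :=
  fun a ha => (h.mem_left a).1 ha

theorem QuotExact.le_right (h : QuotExact φ ψ W₁ W₂ W₃) : W₂ ≤ W₃.comap ψ :=
  fun b hb => (h.mem_right b).2 ⟨0, by simpa using hb⟩

theorem QuotExact.injective (h : QuotExact φ ψ W₁ W₂ W₃) :
    Function.Injective (W₁.mapQ W₂ φ h.le_left) := by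
  rw [← LinearMap.ker_eq_bot, LinearMap.ker_eq_bot']
  intro x hx
  obtain ⟨a, rfl⟩ := W₁.mkQ_surjective x
  simpa [h.mem_left] using hx

theorem QuotExact.surjective (h : QuotExact φ ψ W₁ W₂ W₃) :
    Function.Surjective (W₂.mapQ W₃ ψ h.le_right) := by
  intro x
  obtain ⟨c, rfl⟩ := W₃.mkQ_surjective x
  obtain ⟨b, rfl⟩ := h.surj c
  exact ⟨W₂.mkQ b, by simp⟩

theorem QuotExact.exact (h : QuotExact φ ψ W₁ W₂ W₃) :
    Function.Exact (W₁.mapQ W₂ φ h.le_left) (W₂.mapQ W₃ ψ h.le_right) := by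
  intro x
  obtain ⟨b, rfl⟩ := W₂.mkQ_surjective x
  have h1 : (W₂.mapQ W₃ ψ h.le_right) (W₂.mkQ b) = 0 ↔ ψ b ∈ W₃ := by simp
  rw [h1, h.mem_right]
  constructor
  · rintro ⟨a, ha⟩
    refine ⟨W₁.mkQ a, ?_⟩
    have := (Submodule.Quotient.eq W₂).2 ha
    simpa using this.symm
  · rintro ⟨y, hy⟩
    obtain ⟨a, rfl⟩ := W₁.mkQ_surjective y
    refine ⟨a, (Submodule.Quotient.eq W₂).1 ?_⟩
    simpa using hy.symm

theorem QuotExact.subsingleton_middle (h : QuotExact φ ψ W₁ W₂ W₃) {i : ℕ}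
    (hA : Subsingleton (ExtSelf R (A ⧸ W₁) i)) (hC : Subsingleton (ExtSelf R (C ⧸ W₃) i)) :
    Subsingleton (ExtSelf R (B ⧸ W₂) i) :=
  extSelf_subsingleton_middle _ _ h.injective h.surjective h.exact hA hC

theorem QuotExact.subsingleton_left (h : QuotExact φ ψ W₁ W₂ W₃) {i : ℕ}
    (hB : Subsingleton (ExtSelf R (B ⧸ W₂) i))
    (hC : Subsingleton (ExtSelf R (C ⧸ W₃) (i + 1))) :
    Subsingleton (ExtSelf R (A ⧸ W₁) i) :=
  extSelf_subsingleton_left _ _ h.injective h.surjective h.exact hB hC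

theorem QuotExact.subsingleton_right (h : QuotExact φ ψ W₁ W₂ W₃) {i : ℕ}
    (hA : Subsingleton (ExtSelf R (A ⧸ W₁) i))
    (hB : Subsingleton (ExtSelf R (B ⧸ W₂) (i + 1))) :
    Subsingleton (ExtSelf R (C ⧸ W₃) (i + 1)) :=
  extSelf_subsingleton_right _ _ h.injective h.surjective h.exact hA hB

theorem extSelf_subsingleton_quot_pi {τ : Type} [Fintype τ] (L : τ → Ideal R) {i : ℕ}
    (h : ∀ t, Subsingleton (ExtSelf R (R ⧸ L t) i)) :
    Subsingleton (ExtSelf R ((τ → R) ⧸ Submodule.pi Set.univ L) i) := by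
  classical
  exact extSelf_subsingleton_of_equiv (Submodule.quotientPi L)
    (extSelf_subsingleton_pi (fun t => R ⧸ L t) h)

theorem extSelf_subsingleton_of_projective [Module.Projective R A] (i : ℕ) (hi : 0 < i) :
    Subsingleton (ExtSelf R A i) := by
  obtain ⟨i, rfl⟩ := Nat.exists_eq_succ_of_ne_zero hi.ne'
  have : Projective (ModuleCat.of R A) := (IsProjective.iff_projective A).1 inferInstance
  exact subsingleton_of_forall_eq 0 Ext.eq_zero_of_projective

end Quotients

end Homological

section Comparison

open CategoryTheory.Abelian

variable {R : Type} [CommRing R]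

theorem mem_annihilator_of_linearEquiv {M N : Type*} [AddCommGroup M] [AddCommGroup N] [Module R M]
    [Module R N] (e : M ≃ₗ[R] N) (r : R) :
    r ∈ Module.annihilator R M ↔ r ∈ Module.annihilator R N := by
  rw [e.annihilator_eq]

theorem mem_annihilator_homology_iff (S : ShortComplex (ModuleCat.{0} R)) (r : R) :
    r ∈ Module.annihilator R S.homology ↔
      ∀ z : S.X₂, S.g z = 0 → ∃ b : S.X₁, S.f b = r • z := by
  rw [mem_annihilator_of_linearEquiv S.moduleCatHomologyIso.toLinearEquiv]
  change r ∈ Module.annihilator R (LinearMap.ker S.g.hom ⧸ LinearMap.range S.moduleCatToCycles) ↔ _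
  rw [Module.mem_annihilator]
  constructor
  · intro h z hz
    have h1 := h ((LinearMap.range S.moduleCatToCycles).mkQ ⟨z, hz⟩)
    rw [← map_smul, Submodule.mkQ_apply, Submodule.Quotient.mk_eq_zero] at h1
    obtain ⟨b, hb⟩ := h1
    exact ⟨b, congrArg Subtype.val hb⟩
  · intro h x
    obtain ⟨⟨z, hz⟩, rfl⟩ := (LinearMap.range S.moduleCatToCycles).mkQ_surjective x
    obtain ⟨b, hb⟩ := h z hz
    rw [← map_smul, Submodule.mkQ_apply, Submodule.Quotient.mk_eq_zero]
    exact ⟨b, Subtype.ext hb⟩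

theorem mem_annihilator_extM_iff {X : ModuleCat.{0} R} (P : ProjectiveResolution X)
    (Y : ModuleCat.{0} R) (i : ℕ) (r : R) :
    r ∈ Module.annihilator R (extM X Y i) ↔
      ∀ f : P.complex.X i ⟶ Y, P.complex.d (i + 1) i ≫ f = 0 →
        ∃ g : P.complex.X ((ComplexShape.up ℕ).prev i) ⟶ Y,
          P.complex.d i ((ComplexShape.up ℕ).prev i) ≫ g = r • f := by
  refine (mem_annihilator_of_linearEquiv (P.isoExt (R := R) i Y).toLinearEquiv r).trans ?_
  rw [show i + 1 = (ComplexShape.up ℕ).next i by simp]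
  exact mem_annihilator_homology_iff ((P.complex.linearYonedaObj R Y).sc i) r

theorem smul_extMk {X Y : ModuleCat.{0} R} (P : ProjectiveResolution X) {i : ℕ}
    (f : P.complex.X i ⟶ Y) (hf : P.complex.d (i + 1) i ≫ f = 0) (r : R) :
    r • P.extMk f (i + 1) rfl hf =
      P.extMk (r • f) (i + 1) rfl (by rw [Linear.comp_smul, hf, smul_zero]) := by
  rw [Ext.smul_eq_comp_mk₀, P.extMk_comp_mk₀]
  simp only [Linear.comp_smul, Category.comp_id]

theorem annihilator_extM_le (M : Type) [AddCommGroup M] [Module R M] (i : ℕ) :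
    Module.annihilator R (extM (ModuleCat.of R M) (ModuleCat.of R R) i) ≤
      Module.annihilator R (ExtSelf R M i) := by
  intro r hr
  let P := projectiveResolution (ModuleCat.of R M)
  rw [mem_annihilator_extM_iff P] at hr
  rw [Module.mem_annihilator]
  intro x
  obtain ⟨f, hf, rfl⟩ := P.extMk_surjective x (i + 1) rfl
  rw [smul_extMk]
  have h := hr f hf
  cases i with
  | zero =>
    obtain ⟨g, hg⟩ := h
    have : r • f = 0 := by
      rw [← hg, HomologicalComplex.shape _ _ _ (by simp), Limits.zero_comp]
    simp only [this, P.extMk_zero]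
  | succ i =>
    rw [P.extMk_eq_zero_iff _ _ _ _ i rfl]
    rwa [CochainComplex.prev_nat_succ] at h

theorem annihilator_extM_succ (M : Type) [AddCommGroup M] [Module R M] (i : ℕ) :
    Module.annihilator R (extM (ModuleCat.of R M) (ModuleCat.of R R) (i + 1)) =
      Module.annihilator R (ExtSelf R M (i + 1)) := by
  refine le_antisymm (annihilator_extM_le M _) fun r hr => ?_
  let P := projectiveResolution (ModuleCat.of R M)
  rw [mem_annihilator_extM_iff P]
  intro f hf
  have h := Module.mem_annihilator.1 hr (P.extMk f _ rfl hf)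
  rw [smul_extMk, P.extMk_eq_zero_iff _ _ _ _ i rfl] at h
  rw [CochainComplex.prev_nat_succ]
  exact h

end Comparison

section MonomialSubmodules

variable {σ k : Type} [Field k]

/-- The component of `f` in the multidegree `m`. -/
noncomputable def comp (m : σ →₀ ℕ) (f : MvPolynomial σ k) : MvPolynomial σ k :=
  monomial m (coeff m f)

@[simp]
theorem comp_zero (m : σ →₀ ℕ) : comp m (0 : MvPolynomial σ k) = 0 := by simp [comp]

theorem comp_add (m : σ →₀ ℕ) (f g : MvPolynomial σ k) : comp m (f + g) = comp m f + comp m g := by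
  simp [comp]

theorem comp_sub (m : σ →₀ ℕ) (f g : MvPolynomial σ k) : comp m (f - g) = comp m f - comp m g := by
  simp [comp]

theorem comp_X_mul (i : σ) (m : σ →₀ ℕ) (f : MvPolynomial σ k) :
    comp (m + Finsupp.single i 1) (X i * f) = X i * comp m f := by
  rw [comp, comp, add_comm m, coeff_X_mul, X, monomial_mul, one_mul]

theorem comp_add_single (i : σ) (m : σ →₀ ℕ) (f : MvPolynomial σ k) :
    comp (m + Finsupp.single i 1) f = X i * monomial m (coeff (m + Finsupp.single i 1) f) := by
  rw [comp, X, monomial_mul, one_mul, add_comm m]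

theorem sum_comp_of_support_subset (f : MvPolynomial σ k) {s : Finset (σ →₀ ℕ)}
    (h : f.support ⊆ s) : ∑ m ∈ s, comp m f = f := by
  conv_rhs => rw [f.as_sum]
  refine (Finset.sum_subset h fun m _ hm => ?_).symm
  rw [comp, notMem_support_iff.1 hm, map_zero]

/-- `J` is a monomial ideal, whose minimal generators only involve the variables in `C`. -/
def IsMon (C : Finset σ) (J : Ideal (MvPolynomial σ k)) : Prop :=
  (∀ f ∈ J, ∀ m, comp m f ∈ J) ∧ ∀ i ∉ C, ∀ f, X i * f ∈ J → f ∈ J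

theorem IsMon.mem_iff {C : Finset σ} {J : Ideal (MvPolynomial σ k)} (h : IsMon C J)
    (f : MvPolynomial σ k) : f ∈ J ↔ ∀ m, comp m f ∈ J :=
  ⟨h.1 f, fun hf => sum_comp_of_support_subset f subset_rfl ▸ J.sum_mem fun m _ => hf m⟩

theorem IsMon.mono {C D : Finset σ} {J : Ideal (MvPolynomial σ k)} (h : IsMon C J) (hCD : C ⊆ D) :
    IsMon D J :=
  ⟨h.1, fun i hi => h.2 i fun hc => hi (hCD hc)⟩

theorem IsMon.sup [DecidableEq σ] {C D : Finset σ} {I J : Ideal (MvPolynomial σ k)}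
    (hI : IsMon C I) (hJ : IsMon D J) : IsMon (C ∪ D) (I ⊔ J) := by
  have h1 : ∀ f ∈ I ⊔ J, ∀ m, comp m f ∈ I ⊔ J := by
    intro f hf m
    obtain ⟨a, ha, b, hb, rfl⟩ := Submodule.mem_sup.1 hf
    rw [comp_add]
    exact Submodule.add_mem_sup (hI.1 a ha m) (hJ.1 b hb m)
  refine ⟨h1, fun i hi f hf => ?_⟩
  rw [Finset.mem_union, not_or] at hi
  obtain ⟨a, ha, b, hb, hab⟩ := Submodule.mem_sup.1 hf
  rw [← sum_comp_of_support_subset f subset_rfl]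
  refine Ideal.sum_mem _ fun m _ => ?_
  have hm : X i * comp m f =
      X i * (monomial m (coeff (m + Finsupp.single i 1) a) +
        monomial m (coeff (m + Finsupp.single i 1) b)) := by
    rw [mul_add, ← comp_add_single, ← comp_add_single, ← comp_X_mul, ← hab, comp_add]
  rw [mul_left_cancel₀ (X_ne_zero i) hm]
  refine Submodule.add_mem_sup (hI.2 i hi.1 _ ?_) (hJ.2 i hi.2 _ ?_)
  · rw [← comp_add_single]
    exact hI.1 a ha _
  · rw [← comp_add_single]
    exact hJ.1 b hb _

theorem IsMon.iInf {ι : Type} {C : Finset σ} {J : ι → Ideal (MvPolynomial σ k)}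
    (h : ∀ t, IsMon C (J t)) : IsMon C (⨅ t, J t) := by
  refine ⟨fun f hf m => ?_, fun i hi f hf => ?_⟩
  · rw [Submodule.mem_iInf] at hf ⊢
    exact fun t => (h t).1 f (hf t) m
  · rw [Submodule.mem_iInf] at hf ⊢
    exact fun t => (h t).2 i hi f (hf t)

/-- A submodule of a free module which is homogeneous for the fine grading (all basis vectors in
degree `0`) and whose minimal generators only involve the variables in `C`. -/
def IsMonSub {τ : Type} (C : Finset σ) (W : Submodule (MvPolynomial σ k) (τ → MvPolynomial σ k)) :
    Prop :=
  (∀ f ∈ W, ∀ m, (fun t => comp m (f t)) ∈ W) ∧ ∀ i ∉ C, ∀ f, (X i : MvPolynomial σ k) • f ∈ W → f ∈ W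

theorem mem_of_comp_mem {τ : Type} [Finite τ]
    {W : Submodule (MvPolynomial σ k) (τ → MvPolynomial σ k)} {f : τ → MvPolynomial σ k}
    (h : ∀ m, (fun t => comp m (f t)) ∈ W) : f ∈ W := by
  classical
  have := Fintype.ofFinite τ
  have : f = ∑ m ∈ Finset.univ.biUnion fun t => (f t).support, fun t => comp m (f t) := by
    ext1 t
    rw [Finset.sum_apply, sum_comp_of_support_subset]
    exact Finset.subset_biUnion_of_mem (fun t => (f t).support) (Finset.mem_univ t)
  rw [this]
  exact W.sum_mem fun m _ => h m

theorem IsMonSub.sup {τ : Type} [Finite τ] [DecidableEq σ] {C D : Finset σ}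
    {V W : Submodule (MvPolynomial σ k) (τ → MvPolynomial σ k)}
    (hV : IsMonSub C V) (hW : IsMonSub D W) : IsMonSub (C ∪ D) (V ⊔ W) := by
  have h1 : ∀ f ∈ V ⊔ W, ∀ m, (fun t => comp m (f t)) ∈ V ⊔ W := by
    intro f hf m
    obtain ⟨a, ha, b, hb, rfl⟩ := Submodule.mem_sup.1 hf
    simp only [Pi.add_apply, comp_add]
    exact Submodule.add_mem_sup (hV.1 a ha m) (hW.1 b hb m)
  refine ⟨h1, fun i hi f hf => mem_of_comp_mem fun m => ?_⟩
  rw [Finset.mem_union, not_or] at hi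
  obtain ⟨a, ha, b, hb, hab⟩ := Submodule.mem_sup.1 hf
  have hm : (fun t => comp m (f t)) =
      (fun t => monomial m (coeff (m + Finsupp.single i 1) (a t))) +
        fun t => monomial m (coeff (m + Finsupp.single i 1) (b t)) := by
    ext1 t
    refine mul_left_cancel₀ (X_ne_zero (R := k) i) ?_
    rw [Pi.add_apply, mul_add, ← comp_add_single, ← comp_add_single, ← comp_X_mul, ← comp_add]
    exact congrArg _ (congrFun hab t).symm
  rw [hm]
  refine Submodule.add_mem_sup (hV.2 i hi.1 _ ?_) (hW.2 i hi.2 _ ?_)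
  · convert hV.1 a ha (m + Finsupp.single i 1) using 2 with t
    rw [comp_add_single]
    rfl
  · convert hW.1 b hb (m + Finsupp.single i 1) using 2 with t
    rw [comp_add_single]
    rfl

theorem isMonSub_pi {τ : Type} {C : Finset σ} {L : τ → Ideal (MvPolynomial σ k)}
    (h : ∀ t, IsMon C (L t)) : IsMonSub C (Submodule.pi Set.univ L) :=
  ⟨fun _ hf m t ht => (h t).1 _ (hf t ht) m, fun i hi _ hf t ht => (h t).2 i hi _ (hf t ht)⟩

theorem isMonSub_range {τ τ' : Type} [Finite τ] {C : Finset σ}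
    (φ : (τ' → MvPolynomial σ k) →ₗ[MvPolynomial σ k] (τ → MvPolynomial σ k))
    (h : ∀ m f, φ (fun t => comp m (f t)) = fun t => comp m (φ f t)) :
    IsMonSub C (LinearMap.range φ) := by
  refine ⟨?_, fun i hi f hf => mem_of_comp_mem fun m => ?_⟩
  · rintro _ ⟨f, rfl⟩ m
    exact ⟨_, h m f⟩
  · obtain ⟨g, hg⟩ := hf
    refine ⟨fun t => monomial m (coeff (m + Finsupp.single i 1) (g t)), ?_⟩
    have h1 : (X i : MvPolynomial σ k) •
        φ (fun t => monomial m (coeff (m + Finsupp.single i 1) (g t))) =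
        (X i : MvPolynomial σ k) • fun t => comp m (f t) := by
      rw [← map_smul]
      have : (X i : MvPolynomial σ k) •
          (fun t => monomial m (coeff (m + Finsupp.single i 1) (g t))) =
          fun t => comp (m + Finsupp.single i 1) (g t) := by
        ext1 t
        rw [comp_add_single]
        rfl
      rw [this, h, hg]
      ext1 t
      exact comp_X_mul i m (f t)
    ext1 t
    exact mul_left_cancel₀ (X_ne_zero (R := k) i) (congrFun h1 t)

theorem isMon_span_monomial {C : Finset σ} {p : σ →₀ ℕ} (hp : ∀ i ∉ C, p i = 0) :
    IsMon C (Ideal.span {monomial p (1 : k)}) := by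
  classical
  have key : ∀ f : MvPolynomial σ k, f ∈ Ideal.span {monomial p (1 : k)} ↔
      ∀ m ∈ f.support, p ≤ m := by
    intro f
    have := mem_ideal_span_monomial_image (R := k) (x := f) (s := {p})
    simpa using this
  refine ⟨fun f hf m => ?_, fun j hj f hf => ?_⟩
  · rw [key] at hf ⊢
    intro m' hm'
    simp only [comp, mem_support_iff, coeff_monomial] at hm'
    split_ifs at hm' with h
    · exact h ▸ hf m (mem_support_iff.2 hm')
    · exact (hm' rfl).elim
  · rw [key] at hf ⊢
    intro m hm i
    by_cases hij : i = j
    · simp [hij, hp j hj]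
    · have := hf (Finsupp.single j 1 + m) (by
        rw [mem_support_iff, coeff_X_mul]
        exact mem_support_iff.1 hm) i
      simpa [Finsupp.single_apply, Ne.symm hij] using this

end MonomialSubmodules

section Vanishing

variable {σ k : Type} [Field k]

theorem comp_mem_iff {J : Ideal (MvPolynomial σ k)} {m : σ →₀ ℕ} {f : MvPolynomial σ k}
    (hm : m ∈ f.support) : comp m f ∈ J ↔ monomial m (1 : k) ∈ J := by
  have hc : coeff m f ≠ 0 := mem_support_iff.1 hm
  have h1 : comp m f = C (coeff m f) * monomial m 1 := by simp [comp, C_mul_monomial]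
  have h2 : monomial m (1 : k) = C (coeff m f)⁻¹ * comp m f := by
    simp [comp, C_mul_monomial, hc]
  exact ⟨fun h => h2 ▸ J.mul_mem_left _ h, fun h => h1 ▸ J.mul_mem_left _ h⟩

/-- The ideal of `J`-monomials from which the variable `x` has been removed. -/
noncomputable def dehomog (x : σ) (J : Ideal (MvPolynomial σ k)) : Ideal (MvPolynomial σ k) :=
  restrictSupportIdeal k {m | monomial (m.erase x) (1 : k) ∈ J} (by
    intro a b hab ha
    have : monomial (b.erase x) (1 : k) = monomial (b.erase x - a.erase x) 1 * monomial (a.erase x) 1 := by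
      rw [monomial_mul, one_mul, tsub_add_cancel_of_le]
      intro i
      by_cases h : i = x
      · simp [h]
      · simpa [h] using hab i
    change monomial (b.erase x) (1 : k) ∈ J
    exact this ▸ J.mul_mem_left _ ha)

theorem mem_dehomog {x : σ} {J : Ideal (MvPolynomial σ k)} {f : MvPolynomial σ k} :
    f ∈ dehomog x J ↔ ∀ m ∈ f.support, monomial (m.erase x) (1 : k) ∈ J := Iff.rfl

theorem isMon_dehomog [DecidableEq σ] {C : Finset σ} {x : σ} {J : Ideal (MvPolynomial σ k)}
    (hJ : IsMon (insert x C) J) : IsMon C (dehomog x J) := by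
  refine ⟨fun f hf m => ?_, fun i hi f hf => ?_⟩
  · rw [mem_dehomog] at hf ⊢
    intro m' hm'
    simp only [comp, mem_support_iff, coeff_monomial] at hm'
    split_ifs at hm' with h
    · exact h ▸ hf m (mem_support_iff.2 hm')
    · exact (hm' rfl).elim
  · rw [mem_dehomog] at hf ⊢
    intro m hm
    have h1 := hf (Finsupp.single i 1 + m) (by
      rw [mem_support_iff, coeff_X_mul]
      exact mem_support_iff.1 hm)
    by_cases hx : i = x
    · subst hx
      simpa [Finsupp.erase_add] using h1
    · refine hJ.2 i (by simp [hx, hi]) _ ?_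
      rw [X, monomial_mul, one_mul]
      rwa [Finsupp.erase_add, Finsupp.erase_single_ne (Ne.symm hx)] at h1

theorem dehomog_sup_span_X [DecidableEq σ] {C : Finset σ} {x : σ} {J : Ideal (MvPolynomial σ k)}
    (hJ : IsMon C J) :
    dehomog x J ⊔ Ideal.span {X x} = J ⊔ Ideal.span {(X x : MvPolynomial σ k)} := by
  apply le_antisymm
  · refine sup_le_sup_right (fun f hf => ?_) _
    rw [hJ.mem_iff]
    intro m
    by_cases hm : m ∈ f.support
    · rw [comp_mem_iff hm]
      have : monomial m (1 : k) = monomial (Finsupp.single x (m x)) 1 * monomial (m.erase x) 1 := by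
        rw [monomial_mul, one_mul, Finsupp.single_add_erase]
      exact this ▸ J.mul_mem_left _ (mem_dehomog.1 hf m hm)
    · simp [comp, notMem_support_iff.1 hm]
  · refine sup_le (fun f hf => ?_) le_sup_right
    rw [← sum_comp_of_support_subset f subset_rfl]
    refine Ideal.sum_mem _ fun m hm => ?_
    by_cases hx : m x = 0
    · refine Ideal.mem_sup_left (mem_dehomog.2 fun m' hm' => ?_)
      have : m' = m := by
        by_contra h
        simp [comp, coeff_monomial, Ne.symm h] at hm'
      rw [this, show m.erase x = m from Finsupp.erase_of_notMem_support (by simpa using hx),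
        ← comp_mem_iff hm]
      exact hJ.1 f hf m
    · refine Ideal.mem_sup_right (Ideal.mem_span_singleton.2 ⟨monomial (m - Finsupp.single x 1)
        (coeff m f), ?_⟩)
      rw [comp, X, monomial_mul, one_mul, add_tsub_cancel_of_le]
      simpa [Finsupp.single_le_iff] using Nat.one_le_iff_ne_zero.2 hx

theorem IsMon.eq_bot_or_eq_top {J : Ideal (MvPolynomial σ k)} (hJ : IsMon ∅ J) :
    J = ⊥ ∨ J = ⊤ := by
  classical
  refine or_iff_not_imp_left.2 fun h => ?_
  obtain ⟨f, hf, hf0⟩ := Submodule.exists_mem_ne_zero_of_ne_bot h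
  obtain ⟨m, hm⟩ := support_nonempty.2 hf0
  have h1 : monomial m (1 : k) ∈ J := (comp_mem_iff hm).1 (hJ.1 f hf m)
  rw [Ideal.eq_top_iff_one]
  clear hm hf
  induction m using Finsupp.induction_linear with
  | zero => simpa using h1
  | single i n =>
    induction n with
    | zero => simpa using h1
    | succ n ih =>
      refine ih (hJ.2 i (by simp) _ ?_)
      rwa [X, monomial_mul, one_mul, ← Finsupp.single_add, add_comm]
  | add a b ha hb =>
    refine ha ?_
    clear ha hb
    induction b using Finsupp.induction_linear generalizing a with
    | zero => simpa using h1
    | single i n =>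
      induction n with
      | zero => simpa using h1
      | succ n ih =>
        refine ih (hJ.2 i (by simp) _ ?_)
        rwa [X, monomial_mul, one_mul, ← add_assoc, add_comm _ a, add_assoc, ← Finsupp.single_add, add_comm 1]
    | add b c hb hc =>
      exact hb a (hc (a + b) (by rwa [add_assoc]))

/-- The ideal quotient `J : r`. -/
noncomputable abbrev colonElem (J : Ideal (MvPolynomial σ k)) (r : MvPolynomial σ k) :
    Ideal (MvPolynomial σ k) :=
  Submodule.comap (LinearMap.mulLeft (MvPolynomial σ k) r) J

theorem quotExact_mul (r : MvPolynomial σ k) (J : Ideal (MvPolynomial σ k)) :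
    QuotExact (LinearMap.mulLeft (MvPolynomial σ k) r) LinearMap.id
      (colonElem J r) J (J ⊔ Ideal.span {r}) where
  surj := Function.surjective_id
  mem_left _ := Iff.rfl
  mem_right b := by
    rw [LinearMap.id_apply, sup_comm, Ideal.mem_span_singleton_sup]
    constructor
    · rintro ⟨a, c, hc, rfl⟩
      exact ⟨a, by simpa [mul_comm] using hc⟩
    · rintro ⟨a, ha⟩
      exact ⟨a, _, ha, by simp [mul_comm]⟩

theorem IsMon.colon [DecidableEq σ] {C : Finset σ} {J : Ideal (MvPolynomial σ k)}
    (hJ : IsMon C J) (x : σ) :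
    IsMon C (colonElem J (X x)) := by
  refine ⟨fun f hf m => ?_, fun i hi f hf => ?_⟩
  · change X x * comp m f ∈ J
    rw [← comp_X_mul]
    exact hJ.1 _ hf _
  · change X x * f ∈ J
    refine hJ.2 i hi _ ?_
    rw [mul_left_comm]
    exact hf

/-- Hilbert's syzygy theorem for monomial ideals in few variables. -/
theorem IsMon.extSelf_subsingleton [Finite σ] {C : Finset σ} {J : Ideal (MvPolynomial σ k)}
    (hJ : IsMon C J) {i : ℕ} (hi : C.card < i) :
    Subsingleton (ExtSelf (MvPolynomial σ k) (MvPolynomial σ k ⧸ J) i) := by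
  classical
  induction C using Finset.induction_on generalizing J i with
  | empty =>
    obtain rfl | rfl := hJ.eq_bot_or_eq_top
    · have := Module.Projective.of_equiv
        (Submodule.quotEquivOfEqBot (⊥ : Ideal (MvPolynomial σ k)) rfl).symm
      exact extSelf_subsingleton_of_projective _ hi
    · exact extSelf_subsingleton_of_subsingleton _
  | insert x C hx ih =>
    rw [Finset.card_insert_of_notMem hx] at hi
    induction J using WellFoundedGT.induction with
    | ind J ihJ =>
      by_cases h : colonElem J (X x) = J
      · refine ih (J := J) ⟨hJ.1, fun j hj f hf => ?_⟩ (by omega)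
        by_cases hjx : j = x
        · subst hjx
          rw [← h]
          exact hf
        · exact hJ.2 j (by simp [hj, hjx]) f hf
      · have hlt : J < colonElem J (X x) :=
          lt_of_le_of_ne (fun f hf => J.mul_mem_left _ hf) (Ne.symm h)
        refine (quotExact_mul (X x) J).subsingleton_middle (ihJ _ hlt (hJ.colon x)) ?_
        obtain ⟨i, rfl⟩ := Nat.exists_eq_succ_of_ne_zero (by omega : i ≠ 0)
        have h0 := isMon_dehomog hJ
        rw [← dehomog_sup_span_X hJ]
        have hcol : colonElem (dehomog x J) (X x) =
            dehomog x J :=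
          le_antisymm (fun f hf => h0.2 x hx f hf) (fun f hf => Ideal.mul_mem_left _ _ hf)
        have := quotExact_mul (X x) (dehomog x J)
        rw [hcol] at this
        exact this.subsingleton_right (ih h0 (by omega)) (ih h0 (by omega))

theorem IsMonSub.extSelf_subsingleton_fin [Finite σ] {C : Finset σ} {r : ℕ}
    {W : Submodule (MvPolynomial σ k) (Fin r → MvPolynomial σ k)}
    (hW : IsMonSub C W) {i : ℕ} (hi : C.card < i) :
    Subsingleton (ExtSelf (MvPolynomial σ k) ((Fin r → MvPolynomial σ k) ⧸ W) i) := by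
  induction r with
  | zero => exact extSelf_subsingleton_of_subsingleton _
  | succ r ih =>
    let φ : MvPolynomial σ k →ₗ[MvPolynomial σ k] (Fin (r + 1) → MvPolynomial σ k) :=
      LinearMap.single _ (fun _ => MvPolynomial σ k) 0
    let ψ : (Fin (r + 1) → MvPolynomial σ k) →ₗ[MvPolynomial σ k] (Fin r → MvPolynomial σ k) :=
      LinearMap.funLeft _ _ Fin.succ
    have hker : ∀ b, ψ b = 0 → b = φ (b 0) := by
      intro b hb
      ext1 t
      refine Fin.cases ?_ (fun t => ?_) t
      · simp [φ]
      · simpa [φ, ψ, LinearMap.funLeft_apply] using congrFun hb t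
    have hq : QuotExact φ ψ (W.comap φ) W (W.map ψ) :=
      { surj := LinearMap.funLeft_surjective_of_injective _ _ _ (Fin.succ_injective r)
        mem_left := fun _ => Iff.rfl
        mem_right := fun b => by
          constructor
          · rintro ⟨w, hw, hwb⟩
            refine ⟨(b - w) 0, ?_⟩
            rw [← hker (b - w) (by rw [map_sub, hwb, sub_self])]
            simpa using hw
          · rintro ⟨a, ha⟩
            refine ⟨_, ha, ?_⟩
            rw [map_sub, sub_eq_self]
            ext1 t
            simp [φ, ψ, LinearMap.funLeft_apply] }
    have hφ : ∀ m f, φ (comp m f) = fun t => comp m (φ f t) := by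
      intro m f
      ext1 t
      refine Fin.cases ?_ (fun t => ?_) t <;> simp [φ]
    refine hq.subsingleton_middle (IsMon.extSelf_subsingleton (C := C) ⟨fun f hf m => ?_,
      fun j hj f hf => ?_⟩ hi) (ih ⟨?_, fun j hj f hf => mem_of_comp_mem fun m => ?_⟩)
    · change φ _ ∈ W
      rw [hφ]
      exact hW.1 _ hf m
    · refine hW.2 j hj (φ f) ?_
      rw [← map_smul]
      exact hf
    · rintro _ ⟨w, hw, rfl⟩ m
      exact ⟨_, hW.1 w hw m, rfl⟩
    · obtain ⟨w, hw, hwf⟩ := hf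
      refine ⟨fun t => monomial m (coeff (m + Finsupp.single j 1) (w t)), hW.2 j hj _ ?_, ?_⟩
      · convert hW.1 w hw (m + Finsupp.single j 1) using 2 with t
        rw [comp_add_single]
        rfl
      · ext1 t
        refine mul_left_cancel₀ (X_ne_zero (R := k) j) ?_
        rw [← comp_X_mul]
        change X j * monomial m (coeff (m + Finsupp.single j 1) (w t.succ)) = _
        rw [← comp_add_single]
        exact congrArg _ (congrFun hwf t)

theorem IsMonSub.extSelf_subsingleton [Finite σ] {τ : Type} [Finite τ] {C : Finset σ}
    {W : Submodule (MvPolynomial σ k) (τ → MvPolynomial σ k)}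
    (hW : IsMonSub C W) {i : ℕ} (hi : C.card < i) :
    Subsingleton (ExtSelf (MvPolynomial σ k) ((τ → MvPolynomial σ k) ⧸ W) i) := by
  obtain ⟨r, ⟨e⟩⟩ := Finite.exists_equiv_fin τ
  let E : (τ → MvPolynomial σ k) ≃ₗ[MvPolynomial σ k] (Fin r → MvPolynomial σ k) :=
    LinearEquiv.funCongrLeft _ _ e.symm
  have hE : ∀ f : τ → MvPolynomial σ k, f ∈ W ↔ E f ∈ W.map E.toLinearMap := by
    intro f
    simp
  refine extSelf_subsingleton_of_equiv (Submodule.Quotient.equiv W (W.map E.toLinearMap) E rfl)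
    (IsMonSub.extSelf_subsingleton_fin (C := C) ⟨?_, fun j hj f hf => ?_⟩ hi)
  · rintro _ ⟨w, hw, rfl⟩ m
    exact ⟨_, hW.1 w hw m, rfl⟩
  · obtain ⟨w, hw, hwf⟩ := hf
    refine ⟨E.symm f, hW.2 j hj _ ?_, by simp⟩
    have : w = (X j : MvPolynomial σ k) • E.symm f := by
      apply E.injective
      rw [map_smul, E.apply_symm_apply]
      exact hwf
    exact this ▸ hw

end Vanishing

section Intersections

variable {R : Type} [CommRing R]

theorem quotExact_of_linearMap {A B : Type} [AddCommGroup A] [AddCommGroup B] [Module R A]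
    [Module R B] (φ : A →ₗ[R] B) (W : Submodule R B) :
    QuotExact φ LinearMap.id (W.comap φ) W (W ⊔ LinearMap.range φ) where
  surj := Function.surjective_id
  mem_left _ := Iff.rfl
  mem_right b := by
    rw [LinearMap.id_apply, Submodule.mem_sup]
    constructor
    · rintro ⟨w, hw, _, ⟨a, rfl⟩, rfl⟩
      exact ⟨a, by simpa using hw⟩
    · rintro ⟨a, ha⟩
      exact ⟨_, ha, _, ⟨a, rfl⟩, by simp⟩

theorem mem_annihilator_extSelf_of_smul_le {J J' : Ideal R} (h : J ≤ J') {r : R}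
    (hr : ∀ f ∈ J', r * f ∈ J) {i : ℕ} (h0 : Subsingleton (ExtSelf R (R ⧸ J') i)) :
    r ∈ Module.annihilator R (ExtSelf R (R ⧸ J) i) := by
  refine mem_annihilator_extSelf_of_factor (Submodule.mapQ J J' LinearMap.id h)
    (Submodule.mapQ J' J (LinearMap.mulLeft R r) hr) r ?_ h0
  ext
  rfl

theorem mul_mem_annihilator_extSelf_of_smul_le {J J' : Ideal R} (h : J ≤ J') {r : R}
    (hr : ∀ f ∈ J', r * f ∈ J) {i : ℕ} {a : R}
    (ha : a ∈ Module.annihilator R (ExtSelf R (R ⧸ J) i)) :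
    a * r ∈ Module.annihilator R (ExtSelf R (R ⧸ J') i) := by
  refine mul_mem_annihilator_extSelf_of_factor (Submodule.mapQ J' J (LinearMap.mulLeft R r) hr)
    (Submodule.mapQ J J' LinearMap.id h) r ?_ ha
  ext
  rfl

theorem annihilator_extSelf_inf_le_sup (I J : Ideal R) {i : ℕ}
    (hI : Subsingleton (ExtSelf R (R ⧸ I) (i + 1)))
    (hJ : Subsingleton (ExtSelf R (R ⧸ J) (i + 1))) :
    Module.annihilator R (ExtSelf R (R ⧸ (I ⊓ J)) i) ≤
      Module.annihilator R (ExtSelf R (R ⧸ (I ⊔ J)) (i + 1)) := by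
  let L : Fin 2 → Ideal R := ![I, J]
  let φ : R →ₗ[R] (Fin 2 → R) := LinearMap.pi fun _ => LinearMap.id
  let ψ : (Fin 2 → R) →ₗ[R] R := 
    LinearMap.proj (R := R) (φ := fun _ => R) 0 - LinearMap.proj (R := R) (φ := fun _ => R) 1
  have hq : QuotExact φ ψ (I ⊓ J) (Submodule.pi Set.univ L) (I ⊔ J) :=
    { surj := fun a => ⟨![a, 0], by simp [ψ]⟩
      mem_left := fun a => by
        simp [Submodule.mem_pi, Fin.forall_fin_two, L, φ]
      mem_right := fun b => by
        simp only [Submodule.mem_pi, Set.mem_univ, true_imp_iff, Fin.forall_fin_two]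
        rw [Submodule.mem_sup]
        constructor
        · rintro ⟨a, ha, c, hc, hac⟩
          refine ⟨b 0 - a, by simpa [φ, L] using ha, ?_⟩
          have hb : b 0 - b 1 = a + c := hac.symm
          have : b 1 - (b 0 - a) = - c := by linear_combination -hb
          change b 1 - (b 0 - a) ∈ J
          rw [this]
          exact J.neg_mem hc
        · rintro ⟨a, h0, h1⟩
          exact ⟨_, h0, _, J.neg_mem h1, by simp [ψ, φ]⟩ }
  refine annihilator_extSelf_le_right _ _ hq.injective hq.surjective hq.exact
    (extSelf_subsingleton_quot_pi L fun t => ?_)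
  fin_cases t
  exacts [hI, hJ]

end Intersections

section MonomialIntersections

variable {σ k : Type} [Field k] {ι : Type}
  {L : ι → Ideal (MvPolynomial σ k)} {C : Finset σ} {D : ι → Finset σ}

/-- The diagonal map into a free module. -/
noncomputable def diagMap (σ k ι : Type) [Field k] :
    MvPolynomial σ k →ₗ[MvPolynomial σ k] (ι → MvPolynomial σ k) :=
  LinearMap.pi fun _ => LinearMap.id

theorem comap_diagMap : (Submodule.pi Set.univ L).comap (diagMap σ k ι) = ⨅ t, L t := by
  ext f
  simp [diagMap, Submodule.mem_pi, Submodule.mem_iInf]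

theorem extSelf_subsingleton_iInf [Finite σ] [Finite ι] (hL : ∀ t, IsMon (D t) (L t)) (hD : ∀ t, D t ⊆ C)
    (hcard : ∀ t, (D t).card < C.card) :
    Subsingleton (ExtSelf (MvPolynomial σ k) (MvPolynomial σ k ⧸ ⨅ t, L t) C.card) := by
  classical
  have := Fintype.ofFinite ι
  have hq := quotExact_of_linearMap (diagMap σ k ι) (Submodule.pi Set.univ L)
  rw [comap_diagMap] at hq
  refine hq.subsingleton_left
    (extSelf_subsingleton_quot_pi L fun t => (hL t).extSelf_subsingleton (hcard t))
    (IsMonSub.extSelf_subsingleton (C := C) ?_ (Nat.lt_succ_self _))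
  have h1 : IsMonSub C (Submodule.pi Set.univ L) := isMonSub_pi fun t => (hL t).mono (hD t)
  have h2 : IsMonSub C (LinearMap.range (diagMap σ k ι)) := by
    have : LinearMap.range (diagMap σ k ι) =
        LinearMap.range (LinearMap.funLeft (MvPolynomial σ k) (MvPolynomial σ k)
          fun _ : ι => ()) := by
      ext f
      constructor
      · rintro ⟨a, rfl⟩
        exact ⟨fun _ => a, rfl⟩
      · rintro ⟨a, rfl⟩
        exact ⟨a (), rfl⟩
    rw [this]
    exact isMonSub_range _ fun _ _ => rfl
  simpa using h1.sup h2

/-- If the family `L` of monomial ideals is connected through the pairs of ideals which together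
miss some variable of `C`, then an extra `Ext` module of the intersection vanishes. -/
theorem extSelf_subsingleton_iInf_of_connected [Finite σ] [Finite ι]
    (hL : ∀ t, IsMon (D t) (L t)) (hD : ∀ t, D t ⊆ C)
    {c : ℕ} (hC : C.card = c + 1) (hcard : ∀ t, (D t).card < c)
    (hconn : ∀ h : ι → MvPolynomial σ k,
      (∀ t t', (∃ i ∈ C, i ∉ D t ∧ i ∉ D t') → h t - h t' ∈ L t ⊔ L t') → ∃ a, ∀ t, h t - a ∈ L t) :
    Subsingleton (ExtSelf (MvPolynomial σ k) (MvPolynomial σ k ⧸ ⨅ t, L t) c) := by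
  classical
  have := Fintype.ofFinite ι
  let τ := {p : ι × ι // ∃ i ∈ C, i ∉ D p.1 ∧ i ∉ D p.2}
  have : Fintype τ := Fintype.ofFinite τ
  let M : τ → Ideal (MvPolynomial σ k) := fun p => L p.1.1 ⊔ L p.1.2
  let δ : (ι → MvPolynomial σ k) →ₗ[MvPolynomial σ k] (τ → MvPolynomial σ k) :=
    LinearMap.pi fun p =>
      LinearMap.proj (R := MvPolynomial σ k) (φ := fun _ => MvPolynomial σ k) p.1.1 -
        LinearMap.proj (R := MvPolynomial σ k) (φ := fun _ => MvPolynomial σ k) p.1.2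
  have hM : ∀ p : τ, IsMon (D p.1.1 ∪ D p.1.2) (M p) := fun p => (hL _).sup (hL _)
  have hMC : ∀ p : τ, D p.1.1 ∪ D p.1.2 ⊆ C := fun p => Finset.union_subset (hD _) (hD _)
  have h1 : IsMonSub C (Submodule.pi Set.univ M) := isMonSub_pi fun p => (hM p).mono (hMC p)
  have h2 : IsMonSub C (LinearMap.range δ) := isMonSub_range δ fun m f => by
    ext1 p
    exact (comp_sub m _ _).symm
  have hτ := (quotExact_of_linearMap δ (Submodule.pi Set.univ M)).subsingleton_left
    (i := c + 1)
    (extSelf_subsingleton_quot_pi M fun p => (hM p).extSelf_subsingleton (by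
      rw [← hC]
      obtain ⟨i, hi, h⟩ := p.2
      refine Finset.card_lt_card ((Finset.ssubset_iff_of_subset (hMC p)).2 ⟨i, hi, ?_⟩)
      simpa using h))
    (IsMonSub.extSelf_subsingleton (C := C) (by simpa using h1.sup h2) (by omega))
  have hq : QuotExact (diagMap σ k ι) LinearMap.id (⨅ t, L t) (Submodule.pi Set.univ L)
      ((Submodule.pi Set.univ M).comap δ) :=
    { surj := Function.surjective_id
      mem_left := fun a => by rw [← comap_diagMap]; rfl
      mem_right := fun h => by
        constructor
        · intro hh
          obtain ⟨a, ha⟩ := hconn h fun t t' htt => hh ⟨(t, t'), htt⟩ trivial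
          exact ⟨a, fun t _ => ha t⟩
        · rintro ⟨a, ha⟩ ⟨⟨t, t'⟩, _⟩ -
          have h1 : h t - h t' = (h t - a) - (h t' - a) := by ring
          change h t - h t' ∈ L t ⊔ L t'
          rw [h1]
          exact sub_mem (Ideal.mem_sup_left (ha t trivial)) (Ideal.mem_sup_right (ha t' trivial)) }
  exact hq.subsingleton_left
    (extSelf_subsingleton_quot_pi L fun t => (hL t).extSelf_subsingleton (hcard t)) hτ

/-- A monomial-wise criterion for a compatible family to come from a single polynomial. -/
theorem exists_sub_mem_of_chains [Finite ι] (hL : ∀ t, IsMon (D t) (L t)) (r : ι → ι → Prop)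
    (hr : ∀ m t t', monomial m (1 : k) ∉ L t → monomial m (1 : k) ∉ L t' →
      Relation.ReflTransGen (fun a b => r a b ∧ monomial m (1 : k) ∉ L a ∧
        monomial m (1 : k) ∉ L b) t t')
    (h : ι → MvPolynomial σ k) (hh : ∀ t t', r t t' → h t - h t' ∈ L t ⊔ L t') :
    ∃ a, ∀ t, h t - a ∈ L t := by
  classical
  have := Fintype.ofFinite ι
  have step : ∀ m t t', r t t' → monomial m (1 : k) ∉ L t → monomial m (1 : k) ∉ L t' →
      coeff m (h t) = coeff m (h t') := by
    intro m t t' htt ht ht'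
    obtain ⟨a, ha, b, hb, hab⟩ := Submodule.mem_sup.1 (hh t t' htt)
    have hca : coeff m a = 0 := by
      by_contra hne
      exact ht ((comp_mem_iff (mem_support_iff.2 hne)).1 ((hL t).1 a ha m))
    have hcb : coeff m b = 0 := by
      by_contra hne
      exact ht' ((comp_mem_iff (mem_support_iff.2 hne)).1 ((hL t').1 b hb m))
    have := congrArg (coeff m) hab
    rw [coeff_add, hca, hcb, coeff_sub, add_zero] at this
    exact (sub_eq_zero.1 this.symm)
  have const : ∀ m t t', monomial m (1 : k) ∉ L t → monomial m (1 : k) ∉ L t' →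
      coeff m (h t) = coeff m (h t') := by
    intro m t t' ht ht'
    have := hr m t t' ht ht'
    clear ht ht'
    induction this with
    | refl => rfl
    | tail _ hbc ih => exact ih.trans (step m _ _ hbc.1 hbc.2.1 hbc.2.2)
  let α : (σ →₀ ℕ) → k := fun m =>
    if H : ∃ t, monomial m (1 : k) ∉ L t then coeff m (h H.choose) else 0
  let s : Finset (σ →₀ ℕ) := Finset.univ.biUnion fun t => (h t).support
  have hα : ∀ m t, monomial m (1 : k) ∉ L t → coeff m (h t) = α m := by
    intro m t ht
    have H : ∃ t, monomial m (1 : k) ∉ L t := ⟨t, ht⟩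
    simp only [α, dif_pos H]
    exact const m t _ ht H.choose_spec
  have hcoeff : ∀ m, coeff m (∑ m ∈ s, monomial m (α m)) = if m ∈ s then α m else 0 := by
    intro m
    simp [coeff_sum, coeff_monomial]
  refine ⟨∑ m ∈ s, monomial m (α m), fun t => ?_⟩
  rw [(hL t).mem_iff]
  intro m
  by_cases hm : monomial m (1 : k) ∈ L t
  · by_cases hz : m ∈ (h t - ∑ m ∈ s, monomial m (α m)).support
    · exact (comp_mem_iff hz).2 hm
    · simp [comp, notMem_support_iff.1 hz]
  · have : coeff m (h t - ∑ m ∈ s, monomial m (α m)) = 0 := by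
      rw [coeff_sub, hcoeff]
      split_ifs with hs
      · rw [hα m t hm, sub_self]
      · rw [sub_zero]
        by_contra hne
        exact hs (Finset.mem_biUnion.2 ⟨t, Finset.mem_univ t, mem_support_iff.2 hne⟩)
    simp [comp, this]

end MonomialIntersections

section DegreeIdeals

variable {σ : Type} (k : Type) [Field k]

/-- The ideal of polynomials all of whose monomials have degree at least `e` in the variables
indexed by `C`; this is the `e`-th power of the prime ideal `(x_i : i ∈ C)`. -/
noncomputable def degIdeal (C : Finset σ) (e : ℕ) : Ideal (MvPolynomial σ k) :=
  restrictSupportIdeal k {m | e ≤ ∑ i ∈ C, m i}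
    fun _ _ hab ha => le_trans (α := ℕ) ha (Finset.sum_le_sum fun i _ => hab i)

variable {k}

theorem mem_degIdeal {C : Finset σ} {e : ℕ} {f : MvPolynomial σ k} :
    f ∈ degIdeal k C e ↔ ∀ m ∈ f.support, e ≤ ∑ i ∈ C, m i := Iff.rfl

theorem monomial_mem_degIdeal {C : Finset σ} {e : ℕ} {m : σ →₀ ℕ} :
    monomial m (1 : k) ∈ degIdeal k C e ↔ e ≤ ∑ i ∈ C, m i := by
  classical
  rw [mem_degIdeal, support_monomial, if_neg one_ne_zero]
  simp

theorem sum_single_add [DecidableEq σ] (C : Finset σ) (i : σ) (m : σ →₀ ℕ) :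
    ∑ j ∈ C, (Finsupp.single i 1 + m : σ →₀ ℕ) j = (if i ∈ C then 1 else 0) + ∑ j ∈ C, m j := by
  simp [Finset.sum_add_distrib, Finsupp.single_apply]

theorem isMon_degIdeal (C : Finset σ) (e : ℕ) : IsMon C (degIdeal k C e) := by
  classical
  refine ⟨fun f hf m => ?_, fun i hi f hf => ?_⟩
  · rw [mem_degIdeal] at hf ⊢
    intro m' hm'
    simp only [comp, mem_support_iff, coeff_monomial] at hm'
    split_ifs at hm' with h
    · exact h ▸ hf m (mem_support_iff.2 hm')
    · exact (hm' rfl).elim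
  · rw [mem_degIdeal] at hf ⊢
    intro m hm
    have := hf (Finsupp.single i 1 + m) (by
      rw [mem_support_iff, coeff_X_mul]
      exact mem_support_iff.1 hm)
    rwa [sum_single_add, if_neg hi, zero_add] at this

theorem degIdeal_empty {e : ℕ} (he : e ≠ 0) : degIdeal k (∅ : Finset σ) e = ⊥ := by
  rw [eq_bot_iff]
  intro f hf
  rw [mem_degIdeal] at hf
  rw [Ideal.mem_bot, ← support_eq_empty, Finset.eq_empty_iff_forall_notMem]
  intro m hm
  simpa [he] using hf m hm

theorem X_mem_degIdeal {C : Finset σ} {i : σ} : (X i : MvPolynomial σ k) ∈ degIdeal k C 1 ↔ i ∈ C := by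
  classical
  have := monomial_mem_degIdeal (k := k) (C := C) (e := 1) (m := Finsupp.single i 1 + 0)
  rw [sum_single_add] at this
  rw [X, ← add_zero (Finsupp.single i 1), this]
  split_ifs with h <;> simp [h]

theorem degIdeal_one_eq_span (C : Finset σ) :
    degIdeal k C 1 = Ideal.span (X '' (C : Set σ)) := by
  ext f
  rw [mem_ideal_span_X_image, mem_degIdeal]
  refine forall₂_congr fun m _ => ?_
  rw [Nat.one_le_iff_ne_zero, Ne, Finset.sum_eq_zero_iff]
  simp

theorem degIdeal_mul_le (C : Finset σ) (a b : ℕ) :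
    degIdeal k C a * degIdeal k C b ≤ degIdeal k C (a + b) := by
  classical
  refine Ideal.mul_le.2 fun f hf g hg => mem_degIdeal.2 fun m hm => ?_
  obtain ⟨m1, h1, m2, h2, rfl⟩ := Finset.mem_add.1 (support_mul f g hm)
  simp only [Finsupp.add_apply, Finset.sum_add_distrib]
  exact add_le_add (hf h1) (hg h2)

theorem degIdeal_eq_pow (C : Finset σ) (e : ℕ) : degIdeal k C e = degIdeal k C 1 ^ e := by
  classical
  apply le_antisymm
  · suffices ∀ m : σ →₀ ℕ, e ≤ ∑ i ∈ C, m i → monomial m (1 : k) ∈ degIdeal k C 1 ^ e by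
      intro f hf
      rw [← sum_comp_of_support_subset f subset_rfl]
      exact Ideal.sum_mem _ fun m hm => (comp_mem_iff hm).2 (this m (hf hm))
    induction e with
    | zero => simp
    | succ e ih =>
      intro m hm
      obtain ⟨i, hi, hmi⟩ : ∃ i ∈ C, m i ≠ 0 := by
        by_contra! h
        rw [Finset.sum_eq_zero h] at hm
        omega
      have hm' : Finsupp.single i 1 + (m - Finsupp.single i 1) = m :=
        add_tsub_cancel_of_le (by simpa [Finsupp.single_le_iff] using Nat.one_le_iff_ne_zero.2 hmi)
      rw [← hm', sum_single_add, if_pos hi] at hm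
      rw [← hm', ← one_mul (1 : k), ← monomial_mul, pow_succ']
      exact Ideal.mul_mem_mul (X_mem_degIdeal.2 hi) (ih _ (by omega))
  · induction e with
    | zero => exact fun f _ => mem_degIdeal.2 fun m _ => Nat.zero_le _
    | succ e ih =>
      rw [pow_succ]
      exact (Ideal.mul_mono_left ih).trans (degIdeal_mul_le C e 1)

theorem mem_support_mul_X [DecidableEq σ] {i : σ} {f : MvPolynomial σ k} {m : σ →₀ ℕ}
    (hm : m ∈ (X i * f).support) : ∃ m' ∈ f.support, m = Finsupp.single i 1 + m' := by
  rw [support_X_mul] at hm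
  obtain ⟨m', h, rfl⟩ := Finset.mem_map.1 hm
  exact ⟨m', h, rfl⟩

theorem colonElem_degIdeal_X {C : Finset σ} {i : σ} (hi : i ∈ C) (e : ℕ) :
    colonElem (degIdeal k C (e + 1)) (X i) = degIdeal k C e := by
  classical
  ext f
  change X i * f ∈ degIdeal k C (e + 1) ↔ f ∈ degIdeal k C e
  rw [mem_degIdeal, mem_degIdeal]
  constructor
  · intro h m hm
    have := h (Finsupp.single i 1 + m) (by
      rw [mem_support_iff, coeff_X_mul]
      exact mem_support_iff.1 hm)
    rw [sum_single_add, if_pos hi] at this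
    omega
  · intro h m hm
    obtain ⟨m', hm', rfl⟩ := mem_support_mul_X hm
    rw [sum_single_add, if_pos hi]
    have := h m' hm'
    omega

theorem degIdeal_one_insert [DecidableEq σ] (C : Finset σ) (x : σ) :
    degIdeal k (insert x C) 1 = degIdeal k C 1 ⊔ Ideal.span {X x} := by
  rw [degIdeal_one_eq_span, degIdeal_one_eq_span, Finset.coe_insert, Set.image_insert_eq,
    Ideal.span_insert, sup_comm]

open CategoryTheory.Abelian in
/-- The top `Ext` module of the ideal of variables is cyclic, with annihilator contained in the
ideal. -/
theorem exists_generator_extSelf_degIdeal [Finite σ] (C : Finset σ) :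
    ∃ e : ExtSelf (MvPolynomial σ k) (MvPolynomial σ k ⧸ degIdeal k C 1) C.card,
      (∀ y, ∃ h : MvPolynomial σ k, h • e = y) ∧
        ∀ g : MvPolynomial σ k, g • e = 0 → g ∈ degIdeal k C 1 := by
  classical
  induction C using Finset.induction_on with
  | empty =>
    rw [degIdeal_empty one_ne_zero, Finset.card_empty]
    let e := Submodule.quotEquivOfEqBot (⊥ : Ideal (MvPolynomial σ k)) rfl
    let E := Ext.linearEquiv₀ (R := MvPolynomial σ k)
      (X := ModuleCat.of (MvPolynomial σ k) (MvPolynomial σ k ⧸ (⊥ : Ideal (MvPolynomial σ k))))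
      (Y := ModuleCat.of (MvPolynomial σ k) (MvPolynomial σ k))
    refine ⟨E.symm (ModuleCat.ofHom e.toLinearMap), fun y => ?_, fun g hg => ?_⟩
    · refine ⟨(E y).hom (Submodule.Quotient.mk 1), ?_⟩
      rw [← map_smul, LinearEquiv.symm_apply_eq]
      have he1 : e 1 = 1 := rfl
      ext
      simp [he1]
    · rw [← map_smul, LinearEquiv.map_eq_zero_iff] at hg
      have := congrArg (fun φ => φ.hom (Submodule.Quotient.mk 1)) hg
      have he1 : e 1 = 1 := rfl
      simpa [he1, degIdeal_empty] using this
  | insert x C hx ih =>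
    obtain ⟨e, he, hann⟩ := ih
    have hq := quotExact_mul (X x) (degIdeal k C 1)
    rw [← degIdeal_one_insert, show colonElem (degIdeal k C 1) (X x) = degIdeal k C 1 from
      le_antisymm (fun f hf => (isMon_degIdeal C 1).2 x hx f hf)
        (fun f hf => Ideal.mul_mem_left _ _ hf)] at hq
    obtain ⟨δ, h1, h2⟩ := exists_connecting _ _ hq.injective hq.surjective hq.exact C.card
    rw [Finset.card_insert_of_notMem hx]
    refine ⟨δ e, fun y => ?_, fun g hg => ?_⟩
    · have := (isMon_degIdeal (k := k) C 1).extSelf_subsingleton (Nat.lt_succ_self _)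
      obtain ⟨z, rfl⟩ := (h2 y).1 (Subsingleton.elim _ _)
      obtain ⟨h, rfl⟩ := he z
      exact ⟨h, (map_smul δ h e).symm⟩
    · rw [← map_smul, h1] at hg
      obtain ⟨y, hy⟩ := hg
      obtain ⟨h, rfl⟩ := he y
      have hX : Submodule.mapQ (degIdeal k C 1) (degIdeal k C 1)
          (LinearMap.mulLeft (MvPolynomial σ k) (X x)) hq.le_left =
          (X x : MvPolynomial σ k) • LinearMap.id := by
        ext
        rfl
      rw [hX, extPull_smul_id, smul_smul, eq_comm, ← sub_eq_zero, ← sub_smul] at hy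
      have := hann _ hy
      rw [degIdeal_one_insert, sup_comm, Ideal.mem_span_singleton_sup]
      exact ⟨h, _, this, by ring⟩

theorem annihilator_extSelf_degIdeal_one_le [Finite σ] (C : Finset σ) :
    Module.annihilator (MvPolynomial σ k)
      (ExtSelf (MvPolynomial σ k) (MvPolynomial σ k ⧸ degIdeal k C 1) C.card) ≤
        degIdeal k C 1 := by
  obtain ⟨e, -, h⟩ := exists_generator_extSelf_degIdeal (k := k) C
  exact fun g hg => h g (Module.mem_annihilator.1 hg e)

theorem annihilator_extSelf_le_of_colonElem [Finite σ] {C : Finset σ} {p : σ →₀ ℕ}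
    {J : Ideal (MvPolynomial σ k)} (hJ : IsMon C J) (hp : ∀ i ∉ C, p i = 0)
    (h : colonElem J (monomial p 1) = degIdeal k C 1) :
    Module.annihilator (MvPolynomial σ k)
      (ExtSelf (MvPolynomial σ k) (MvPolynomial σ k ⧸ J) C.card) ≤ degIdeal k C 1 := by
  classical
  have hq := quotExact_mul (monomial p 1) J
  rw [h] at hq
  refine le_trans (annihilator_extSelf_le_left _ _ hq.injective hq.surjective hq.exact ?_)
    (annihilator_extSelf_degIdeal_one_le C)
  refine IsMon.extSelf_subsingleton (C := C) ?_ (Nat.lt_succ_self _)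
  simpa using hJ.sup (isMon_span_monomial hp)

theorem annihilator_extSelf_degIdeal_two_le [Finite σ] (C : Finset σ) :
    Module.annihilator (MvPolynomial σ k)
      (ExtSelf (MvPolynomial σ k) (MvPolynomial σ k ⧸ degIdeal k C 2) C.card) ≤
        degIdeal k C 1 := by
  rcases C.eq_empty_or_nonempty with rfl | ⟨i, hi⟩
  · have := annihilator_extSelf_degIdeal_one_le (k := k) (∅ : Finset σ)
    rwa [degIdeal_empty one_ne_zero, ← degIdeal_empty two_ne_zero] at this ⊢
  · refine annihilator_extSelf_le_of_colonElem (p := Finsupp.single i 1) (isMon_degIdeal C 2)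
      (fun j hj => ?_) (colonElem_degIdeal_X hi 1)
    rw [Finsupp.single_eq_of_ne]
    rintro rfl
    exact hj hi

end DegreeIdeals

section Connected

variable {V : Type} {K : Set (Finset V)} {F : Finset V}

theorem exists_isFacet_superset [Finite V] {G : Finset V} (hG : G ∈ K) :
    ∃ H, IsFacet K H ∧ G ⊆ H := by
  obtain ⟨H, hGH, hH⟩ := (Set.toFinite K).exists_le_maximal hG
  exact ⟨H, ⟨hH.prop, fun H' h' hHH' => le_antisymm (hH.2 h' hHH') hHH'⟩, hGH⟩

/-- The second symbolic power of the Stanley–Reisner ideal of the star of `F` in `K`: the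
intersection of the squares of the facet ideals over the facets containing `F`. -/
noncomputable def starIdeal [Fintype V] [DecidableEq V] (k : Type) [Field k]
    (K : Set (Finset V)) (F : Finset V) : Ideal (MvPolynomial V k) :=
  ⨅ t : {G // IsFacet K G ∧ F ⊆ G}, degIdeal k t.1ᶜ 2

theorem monomial_notMem_degIdeal_two {k : Type} [Field k] {C : Finset V} {m : V →₀ ℕ} :
    monomial m (1 : k) ∉ degIdeal k C 2 ↔ ∑ i ∈ C, m i ≤ 1 := by
  rw [monomial_mem_degIdeal]
  omega

variable [Fintype V] [DecidableEq V]

theorem exists_vertex_forall_sum_compl_le {G G' : Finset V} {m : V →₀ ℕ}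
    (hFG : F ⊂ G) (hG : ∑ i ∈ Gᶜ, m i ≤ 1) (hG' : ∑ i ∈ G'ᶜ, m i ≤ 1)
    (h : ∀ i ∈ G, i ∈ G' → i ∈ F) :
    ∃ u ∈ G, u ∉ F ∧ ∀ H : Finset V, F ⊆ H → u ∈ H → ∑ i ∈ Hᶜ, m i ≤ 1 := by
  obtain ⟨u, hu, hsum⟩ : ∃ u ∈ G \ F, ∑ i ∈ (G \ F).erase u, m i = 0 := by
    have hle : ∑ i ∈ G \ F, m i ≤ 1 := by
      refine le_trans (Finset.sum_le_sum_of_subset fun i hi => ?_) hG'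
      rw [Finset.mem_sdiff] at hi
      exact Finset.mem_compl.2 fun hi' => hi.2 (h i hi.1 hi')
    by_cases hz : ∀ i ∈ G \ F, m i = 0
    · obtain ⟨u, hu⟩ := Finset.sdiff_nonempty.2 (not_subset_of_ssubset hFG)
      exact ⟨u, hu, Finset.sum_eq_zero fun i hi => hz i (Finset.mem_of_mem_erase hi)⟩
    · push Not at hz
      obtain ⟨u, hu, hmu⟩ := hz
      rw [← Finset.add_sum_erase _ _ hu] at hle
      exact ⟨u, hu, by omega⟩
  rw [Finset.mem_sdiff] at hu
  refine ⟨u, hu.1, hu.2, fun H hFH huH => ?_⟩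
  have hsub : Hᶜ ⊆ Gᶜ ∪ (G \ F).erase u := by
    intro i hi
    simp only [Finset.mem_union, Finset.mem_compl, Finset.mem_erase, Finset.mem_sdiff] at hi ⊢
    by_cases hiG : i ∈ G
    · exact Or.inr ⟨fun e => hi (e ▸ huH), hiG, fun hF => hi (hFH hF)⟩
    · exact Or.inl hiG
  have h1 := Finset.sum_le_sum_of_subset (f := m) hsub
  have h2 := Finset.sum_union_inter (s₁ := Gᶜ) (s₂ := (G \ F).erase u) (f := m)
  omega

/-- If the link of `F` has diameter at most two, then any two facets containing `F` for which
a monomial survives are joined by a chain of such facets, consecutive ones sharing a vertex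
outside `F`. -/
theorem facets_chain_of_diamLE2 (hK : IsComplex K) (hdiam : F ∈ K → diamLE2 (link K F))
    (hcard : ∀ G, IsFacet K G → F ⊆ G → F ≠ G) (m : V →₀ ℕ)
    (t t' : {G // IsFacet K G ∧ F ⊆ G}) (ht : ∑ i ∈ t.1ᶜ, m i ≤ 1)
    (ht' : ∑ i ∈ t'.1ᶜ, m i ≤ 1) :
    Relation.ReflTransGen (fun a b : {G // IsFacet K G ∧ F ⊆ G} =>
      (∃ i ∈ Fᶜ, i ∉ a.1ᶜ ∧ i ∉ b.1ᶜ) ∧ ∑ i ∈ a.1ᶜ, m i ≤ 1 ∧ ∑ i ∈ b.1ᶜ, m i ≤ 1) t t' := by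
  simp only [Finset.mem_compl, not_not]
  by_cases hmeet : ∃ i, i ∉ F ∧ i ∈ t.1 ∧ i ∈ t'.1
  · exact Relation.ReflTransGen.single ⟨hmeet, ht, ht'⟩
  push Not at hmeet
  have hF : F ∈ K := hK.2 _ t.2.1.1 _ t.2.2
  have hss (a : {G // IsFacet K G ∧ F ⊆ G}) : F ⊂ a.1 :=
    a.2.2.ssubset_of_ne (hcard _ a.2.1 a.2.2)
  obtain ⟨u, hut, huF, hu⟩ := exists_vertex_forall_sum_compl_le (hss t) ht ht'
    fun i hi hi' => by_contra fun hiF => hmeet i hiF hi hi'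
  obtain ⟨w, hwt, hwF, hw⟩ := exists_vertex_forall_sum_compl_le (hss t') ht' ht
    fun i hi hi' => by_contra fun hiF => hmeet i hiF hi' hi
  have hlink {v : V} {a : {G // IsFacet K G ∧ F ⊆ G}} (hv : v ∈ a.1) (hvF : v ∉ F) :
      {v} ∈ link K F :=
    ⟨hK.2 _ a.2.1.1 _ (Finset.union_subset (by simpa using hv) a.2.2),
      Finset.singleton_inter_of_notMem hvF⟩
  have hext {v v' : V} (h : ({v, v'} : Finset V) ∈ link K F) :
      ∃ a : {G // IsFacet K G ∧ F ⊆ G}, v ∈ a.1 ∧ v' ∈ a.1 := by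
    obtain ⟨H, hH, hsub⟩ := exists_isFacet_superset h.1
    exact ⟨⟨H, hH, Finset.union_subset_right hsub⟩, hsub (by simp), hsub (by simp)⟩
  rcases hdiam hF u w (hlink hut huF) (hlink hwt hwF) with rfl | h | ⟨z, h, h'⟩
  · exact (hmeet u huF hut hwt).elim
  · obtain ⟨a, hau, haw⟩ := hext h
    exact (Relation.ReflTransGen.single ⟨⟨u, huF, hut, hau⟩, ht, hu _ a.2.2 hau⟩).tail
      ⟨⟨w, hwF, haw, hwt⟩, hu _ a.2.2 hau, ht'⟩
  · have hzF : z ∉ F := fun hz => by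
      have : z ∈ ({u, z} : Finset V) ∩ F := by simp [hz]
      rw [h.2] at this
      simp at this
    obtain ⟨a, hau, haz⟩ := hext h
    obtain ⟨b, hbz, hbw⟩ := hext h'
    exact ((Relation.ReflTransGen.single ⟨⟨u, huF, hut, hau⟩, ht, hu _ a.2.2 hau⟩).tail
      ⟨⟨z, hzF, haz, hbz⟩, hu _ a.2.2 hau, hw _ b.2.2 hbw⟩).tail
        ⟨⟨w, hwF, hbw, hwt⟩, hw _ b.2.2 hbw, ht'⟩

theorem extSelf_starIdeal_subsingleton {k : Type} [Field k] {c : ℕ} (hK : IsComplex K)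
    (hdiam : F ∈ K → diamLE2 (link K F)) (hc : Fᶜ.card = c + 1)
    (hcard : ∀ G, IsFacet K G → F ⊆ G → F.card + 2 ≤ G.card) :
    Subsingleton (ExtSelf (MvPolynomial V k) (MvPolynomial V k ⧸ starIdeal k K F) c) := by
  have hL (t : {G // IsFacet K G ∧ F ⊆ G}) : IsMon t.1ᶜ (degIdeal k t.1ᶜ 2) := isMon_degIdeal _ _
  refine extSelf_subsingleton_iInf_of_connected (C := Fᶜ) hL
    (fun t => Finset.compl_subset_compl.2 t.2.2) hc (fun t => ?_)
    fun h hh => exists_sub_mem_of_chains hL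
      (fun t t' => ∃ i ∈ Fᶜ, i ∉ t.1ᶜ ∧ i ∉ t'.1ᶜ) (fun m t t' ht ht' => ?_) h hh
  · have h1 := hcard _ t.2.1 t.2.2
    have h2 := t.1.card_add_card_compl
    have h3 := F.card_add_card_compl
    omega
  · simp only [monomial_notMem_degIdeal_two] at ht ht' ⊢
    refine facets_chain_of_diamLE2 hK hdiam (fun G hG hFG e => ?_) m t t' ht ht'
    have := hcard G hG hFG
    rw [e] at this
    omega

end Connected

section Disconnected

theorem IsMon.monomial_mem_sup {σ k : Type} [Field k] {C D : Finset σ}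
    {I J : Ideal (MvPolynomial σ k)} (hI : IsMon C I) (hJ : IsMon D J) {m : σ →₀ ℕ}
    (h : monomial m (1 : k) ∈ I ⊔ J) : monomial m (1 : k) ∈ I ∨ monomial m (1 : k) ∈ J := by
  classical
  obtain ⟨a, ha, b, hb, hab⟩ := Submodule.mem_sup.1 h
  by_cases hm : m ∈ a.support
  · exact Or.inl ((comp_mem_iff hm).1 (hI.1 a ha m))
  · refine Or.inr ((comp_mem_iff (f := b) ?_).1 (hJ.1 b hb m))
    have := congrArg (coeff m) hab
    rw [coeff_add, notMem_support_iff.1 hm, zero_add, coeff_monomial, if_pos rfl] at this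
    rw [mem_support_iff, this]
    exact one_ne_zero

theorem IsMon.colonElem_monomial_eq_degIdeal {σ k : Type} [Field k] {C D : Finset σ}
    {J : Ideal (MvPolynomial σ k)} {p : σ →₀ ℕ} (hJ : IsMon D J)
    (h : ∀ m, monomial (p + m) (1 : k) ∈ J ↔ 1 ≤ ∑ i ∈ C, m i) :
    colonElem J (monomial p 1) = degIdeal k C 1 := by
  ext f
  change monomial p 1 * f ∈ J ↔ f ∈ degIdeal k C 1
  rw [mem_degIdeal]
  constructor
  · intro hf m hm
    rw [← h, ← comp_mem_iff (f := monomial p 1 * f)]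
    · exact hJ.1 _ hf _
    · rw [mem_support_iff, coeff_monomial_mul, one_mul]
      exact mem_support_iff.1 hm
  · intro hf
    rw [← sum_comp_of_support_subset f subset_rfl, Finset.mul_sum]
    refine J.sum_mem fun m hm => ?_
    have := J.mul_mem_left (MvPolynomial.C (coeff m f)) ((h m).2 (hf m hm))
    rwa [C_mul_monomial, mul_one, ← one_mul (coeff m f), ← monomial_mul] at this

variable {V : Type} {K : Set (Finset V)} {F : Finset V} [DecidableEq V]

theorem pair_mem_link {G : Finset V} {v w : V} (hK : IsComplex K) (hG : IsFacet K G) (hFG : F ⊆ G)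
    (hv : v ∈ G) (hw : w ∈ G) (hvF : v ∉ F) (hwF : w ∉ F) : ({v, w} : Finset V) ∈ link K F := by
  refine ⟨hK.2 _ hG.1 _ (Finset.union_subset ?_ hFG), ?_⟩
  · simp [Finset.insert_subset_iff, hv, hw]
  · rw [← Finset.disjoint_iff_inter_eq_empty]
    simp [hvF, hwF]

variable [Fintype V]

theorem colonElem_sup_eq_degIdeal {k : Type} [Field k] {u w : V}
    (hK : IsComplex K) (hu : {u} ∈ link K F) (hw : {w} ∈ link K F)
    (huw : ({u, w} : Finset V) ∉ link K F)
    (hz : ∀ z, ({u, z} : Finset V) ∈ link K F → ({z, w} : Finset V) ∉ link K F) :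
    colonElem ((⨅ t : {G // IsFacet K G ∧ F ⊆ G ∧ u ∈ G}, degIdeal k t.1ᶜ 2) ⊔
      ⨅ t : {G // IsFacet K G ∧ F ⊆ G ∧ u ∉ G}, degIdeal k t.1ᶜ 2)
        (monomial (Finsupp.single u 1 + Finsupp.single w 1) 1) = degIdeal k Fᶜ 1 := by
  have huF : u ∉ F := by
    intro h
    have h2 := hu.2
    rw [Finset.singleton_inter_of_mem h] at h2
    simp at h2
  have hwF : w ∉ F := by
    intro h
    have h2 := hw.2
    rw [Finset.singleton_inter_of_mem h] at h2
    simp at h2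
  have hU : IsMon Finset.univ
      (⨅ t : {G // IsFacet K G ∧ F ⊆ G ∧ u ∈ G}, degIdeal k t.1ᶜ 2) :=
    IsMon.iInf fun t => (isMon_degIdeal _ _).mono (Finset.subset_univ _)
  have hW : IsMon Finset.univ
      (⨅ t : {G // IsFacet K G ∧ F ⊆ G ∧ u ∉ G}, degIdeal k t.1ᶜ 2) :=
    IsMon.iInf fun t => (isMon_degIdeal _ _).mono (Finset.subset_univ _)
  refine (hU.sup hW).colonElem_monomial_eq_degIdeal fun m => ⟨fun h => ?_, fun h => ?_⟩
  · by_contra hm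
    have hzero (G : Finset V) (hFG : F ⊆ G) : ∑ i ∈ Gᶜ, m i = 0 := by
      have := Finset.sum_le_sum_of_subset (f := m) (Finset.compl_subset_compl.2 hFG)
      omega
    rcases hU.monomial_mem_sup hW h with h | h
    · obtain ⟨G, hG, hsub⟩ := exists_isFacet_superset hu.1
      have huG : u ∈ G := hsub (by simp)
      have hFG : F ⊆ G := Finset.union_subset_right hsub
      have := (Submodule.mem_iInf _).1 h ⟨G, hG, hFG, huG⟩
      rw [monomial_mem_degIdeal, add_assoc, sum_single_add, sum_single_add, hzero G hFG,
        if_neg (by simpa using huG)] at this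
      split_ifs at this <;> omega
    · obtain ⟨G, hG, hsub⟩ := exists_isFacet_superset hw.1
      have hwG : w ∈ G := hsub (by simp)
      have hFG : F ⊆ G := Finset.union_subset_right hsub
      have huG : u ∉ G := fun huG => huw (pair_mem_link hK hG hFG huG hwG huF hwF)
      have := (Submodule.mem_iInf _).1 h ⟨G, hG, hFG, huG⟩
      rw [monomial_mem_degIdeal, add_assoc, sum_single_add, sum_single_add, hzero G hFG,
        if_neg (c := w ∈ Gᶜ) (by simpa using hwG)] at this
      split_ifs at this <;> omega
  · obtain ⟨i, hi, hmi⟩ : ∃ i ∈ Fᶜ, m i ≠ 0 := by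
      by_contra! hc
      rw [Finset.sum_eq_zero hc] at h
      omega
    have hle {G : Finset V} (hiG : i ∉ G) : 1 ≤ ∑ j ∈ Gᶜ, m j :=
      le_trans (Nat.one_le_iff_ne_zero.2 hmi)
        (Finset.single_le_sum (fun _ _ => Nat.zero_le _) (Finset.mem_compl.2 hiG))
    rw [Finset.mem_compl] at hi
    by_cases hex : ∃ G, IsFacet K G ∧ F ⊆ G ∧ u ∈ G ∧ i ∈ G
    · obtain ⟨G₀, hG₀, hFG₀, huG₀, hiG₀⟩ := hex
      refine Ideal.mem_sup_right ((Submodule.mem_iInf _).2 fun ⟨G, hG, hFG, huG⟩ => ?_)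
      change monomial _ 1 ∈ degIdeal k Gᶜ 2
      rw [monomial_mem_degIdeal, add_assoc, sum_single_add, sum_single_add,
        if_pos (by simpa using huG)]
      by_cases hwG : w ∈ G
      · have := hle (G := G) fun hiG => hz i (pair_mem_link hK hG₀ hFG₀ huG₀ hiG₀ huF hi)
          (pair_mem_link hK hG hFG hiG hwG hi hwF)
        omega
      · rw [if_pos (by simpa using hwG)]
        omega
    · push Not at hex
      refine Ideal.mem_sup_left ((Submodule.mem_iInf _).2 fun ⟨G, hG, hFG, huG⟩ => ?_)
      have hwG : w ∉ G := fun hwG => huw (pair_mem_link hK hG hFG huG hwG huF hwF)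
      have := hle (hex G hG hFG huG)
      change monomial _ 1 ∈ degIdeal k Gᶜ 2
      rw [monomial_mem_degIdeal, add_assoc, sum_single_add, sum_single_add,
        if_pos (c := w ∈ Gᶜ) (by simpa using hwG)]
      omega

theorem annihilator_extSelf_starIdeal_le {k : Type} [Field k] {c : ℕ} (hK : IsComplex K)
    (hc : Fᶜ.card = c + 1) (hdiam : ¬ diamLE2 (link K F)) :
    Module.annihilator (MvPolynomial V k)
      (ExtSelf (MvPolynomial V k) (MvPolynomial V k ⧸ starIdeal k K F) c) ≤ degIdeal k Fᶜ 1 := by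
  simp only [diamLE2, not_forall, not_or, not_exists, not_and] at hdiam
  obtain ⟨u, w, hu, hw, -, huw, hz⟩ := hdiam
  have hcard {G : Finset V} (hG : IsFacet K G) (hFG : F ⊆ G) : Gᶜ.card < Fᶜ.card := by
    refine Finset.card_lt_card (Finset.compl_ssubset_compl.2 (hFG.ssubset_of_ne ?_))
    rintro rfl
    have h1 := hG.2 _ hu.1 Finset.subset_union_right
    have h2 := hu.2
    rw [Finset.inter_eq_left.2 (Finset.union_eq_right.1 h1)] at h2
    simp at h2
  have hstar : starIdeal k K F =
      (⨅ t : {G // IsFacet K G ∧ F ⊆ G ∧ u ∈ G}, degIdeal k t.1ᶜ 2) ⊓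
        ⨅ t : {G // IsFacet K G ∧ F ⊆ G ∧ u ∉ G}, degIdeal k t.1ᶜ 2 := by
    simp only [starIdeal, iInf_subtype, ← iInf_inf_eq]
    refine iInf_congr fun G => ?_
    by_cases huG : u ∈ G <;> simp [huG]
  have hU : ∀ t : {G // IsFacet K G ∧ F ⊆ G ∧ u ∈ G}, IsMon t.1ᶜ (degIdeal k t.1ᶜ 2) :=
    fun t => isMon_degIdeal _ _
  have hW : ∀ t : {G // IsFacet K G ∧ F ⊆ G ∧ u ∉ G}, IsMon t.1ᶜ (degIdeal k t.1ᶜ 2) :=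
    fun t => isMon_degIdeal _ _
  have hUF : ∀ t : {G // IsFacet K G ∧ F ⊆ G ∧ u ∈ G}, t.1ᶜ ⊆ Fᶜ :=
    fun t => Finset.compl_subset_compl.2 t.2.2.1
  have hWF : ∀ t : {G // IsFacet K G ∧ F ⊆ G ∧ u ∉ G}, t.1ᶜ ⊆ Fᶜ :=
    fun t => Finset.compl_subset_compl.2 t.2.2.1
  rw [hstar]
  refine le_trans (annihilator_extSelf_inf_le_sup _ _
    (hc ▸ extSelf_subsingleton_iInf hU hUF fun t => hcard t.2.1 t.2.2.1)
    (hc ▸ extSelf_subsingleton_iInf hW hWF fun t => hcard t.2.1 t.2.2.1)) ?_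
  rw [← hc]
  refine annihilator_extSelf_le_of_colonElem (C := Fᶜ) ?_ (fun i hi => ?_)
    (colonElem_sup_eq_degIdeal hK hu hw huw hz)
  · simpa using (IsMon.iInf fun t => (hU t).mono (hUF t)).sup
      (IsMon.iInf fun t => (hW t).mono (hWF t))
  · rw [Finset.mem_compl, not_not] at hi
    have hne {v : V} (hv : {v} ∈ link K F) : v ≠ i := by
      rintro rfl
      have h2 := hv.2
      rw [Finset.singleton_inter_of_mem hi] at h2
      simp at h2
    simp [hne hu, hne hw]

end Disconnected

section Dimension

variable {V : Type} [Fintype V] [DecidableEq V] {k : Type} [Field k]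

theorem ker_killCompl_eq_degIdeal (A : Finset V) :
    RingHom.ker (killCompl (R := k) (Subtype.val_injective (p := (· ∈ A)))) = degIdeal k Aᶜ 1 := by
  apply le_antisymm
  · intro f hf
    have h : ((Ideal.Quotient.mkₐ k (degIdeal k Aᶜ 1)).comp (rename Subtype.val)).comp
        (killCompl (R := k) (Subtype.val_injective (p := (· ∈ A)))) =
          Ideal.Quotient.mkₐ k (degIdeal k Aᶜ 1) := by
      refine algHom_ext fun i => ?_
      by_cases hi : i ∈ A
      · have := killCompl_rename_app (R := k) (Subtype.val_injective (p := (· ∈ A))) (X ⟨i, hi⟩)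
        rw [rename_X] at this
        simp only [AlgHom.comp_apply, this, rename_X]
      · have h0 : Ideal.Quotient.mkₐ k (degIdeal k Aᶜ 1) (X i) = 0 :=
          Ideal.Quotient.eq_zero_iff_mem.2 (X_mem_degIdeal.2 (Finset.mem_compl.2 hi))
        rw [h0]
        simp [killCompl, hi]
    rw [RingHom.mem_ker] at hf
    have := DFunLike.congr_fun h f
    simp only [AlgHom.comp_apply, hf, map_zero] at this
    exact Ideal.Quotient.eq_zero_iff_mem.1 this.symm
  · rw [degIdeal_one_eq_span, Ideal.span_le]
    rintro _ ⟨i, hi, rfl⟩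
    have hi' : i ∉ A := by simpa using hi
    simp [killCompl, hi']

theorem isPrime_degIdeal_one (C : Finset V) : (degIdeal k C 1).IsPrime := by
  rw [← compl_compl C, ← ker_killCompl_eq_degIdeal]
  exact RingHom.ker_isPrime _

theorem ringKrullDim_quotient_degIdeal_compl (A : Finset V) :
    ringKrullDim (MvPolynomial V k ⧸ degIdeal k Aᶜ 1) = A.card := by
  have hsurj : Function.Surjective (killCompl (R := k) (Subtype.val_injective (p := (· ∈ A)))) :=
    fun f => ⟨_, killCompl_rename_app _ f⟩
  rw [← ker_killCompl_eq_degIdeal, ringKrullDim_eq_of_ringEquiv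
    (Ideal.quotientKerAlgEquivOfSurjective hsurj).toRingEquiv,
    MvPolynomial.ringKrullDim_of_isNoetherianRing, ringKrullDim_eq_zero_of_field]
  simp

theorem card_le_ringKrullDim_quotient {a : Ideal (MvPolynomial V k)} {F : Finset V}
    (h : a ≤ degIdeal k Fᶜ 1) : (F.card : WithBot ℕ∞) ≤ ringKrullDim (MvPolynomial V k ⧸ a) :=
  ringKrullDim_quotient_degIdeal_compl (k := k) F ▸
    ringKrullDim_le_of_surjective (Ideal.Quotient.factor h) (Ideal.Quotient.factor_surjective h)

theorem ringKrullDim_quotient_le_of_prod_mem {a : Ideal (MvPolynomial V k)} {q : ℕ}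
    (h : ∀ F : Finset V, F.card = q + 1 → (∏ i ∈ F, X i) ^ 2 ∈ a) :
    ringKrullDim (MvPolynomial V k ⧸ a) ≤ q := by
  classical
  rw [ringKrullDim_quotient]
  refine iSup_le fun p => ?_
  have hP := p.head.1.isPrime
  let A : Finset V := {i | X i ∉ p.head.1.asIdeal}
  have hA : A.card ≤ q := by
    by_contra! hlt
    obtain ⟨F, hFA, hF⟩ := Finset.exists_subset_card_eq (Nat.succ_le_of_lt hlt)
    obtain ⟨i, hi, hmem⟩ := hP.prod_mem_iff.1 (hP.mem_of_pow_mem 2 (p.head.2 (h F hF)))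
    exact (Finset.mem_filter.1 (hFA hi)).2 hmem
  have hle : degIdeal k Aᶜ 1 ≤ p.head.1.asIdeal := by
    rw [degIdeal_one_eq_span, Ideal.span_le]
    rintro _ ⟨i, hi, rfl⟩
    simpa [A] using hi
  let p' : LTSeries (PrimeSpectrum.zeroLocus (R := MvPolynomial V k) (degIdeal k Aᶜ 1)) :=
    LTSeries.mk p.length (fun j => ⟨(p j).1, hle.trans (LTSeries.head_le p j)⟩)
      fun _ _ hij => p.strictMono hij
  have h1 := Order.LTSeries.length_le_krullDim p'
  rw [← ringKrullDim_quotient, ringKrullDim_quotient_degIdeal_compl] at h1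
  exact h1.trans (by exact_mod_cast hA)

end Dimension

section SymbolicPower

theorem subset_of_degIdeal_le {V k : Type} [Field k] {C D : Finset V}
    (h : degIdeal k C 1 ≤ degIdeal k D 1) : C ⊆ D :=
  fun _ hi => X_mem_degIdeal.1 (h (X_mem_degIdeal.2 hi))

variable {V : Type} [Fintype V] [DecidableEq V] {k : Type} [Field k] {K : Set (Finset V)}

theorem exists_facet_degIdeal_le {P : Ideal (MvPolynomial V k)}
    (hP : P.IsPrime) (h : srIdeal k K ≤ P) : ∃ G, IsFacet K G ∧ degIdeal k Gᶜ 1 ≤ P := by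
  classical
  let A : Finset V := {i | X i ∉ P}
  have hA : A ∈ K := by
    by_contra hA
    obtain ⟨i, hi, hmem⟩ := hP.prod_mem_iff.1 (h (Ideal.subset_span ⟨A, hA, rfl⟩))
    exact (Finset.mem_filter.1 hi).2 hmem
  obtain ⟨G, hG, hAG⟩ := exists_isFacet_superset hA
  refine ⟨G, hG, ?_⟩
  rw [degIdeal_one_eq_span, Ideal.span_le]
  rintro _ ⟨i, hi, rfl⟩
  by_contra hiP
  exact Finset.mem_compl.1 hi (hAG (Finset.mem_filter.2 ⟨Finset.mem_univ _, hiP⟩))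

theorem srIdeal_le_degIdeal (hK : IsComplex K) {G : Finset V} (hG : G ∈ K) :
    srIdeal k K ≤ degIdeal k Gᶜ 1 := by
  refine Ideal.span_le.2 ?_
  rintro _ ⟨F, hF, rfl⟩
  obtain ⟨i, hi, hiG⟩ := Finset.not_subset.1 fun hFG => hF (hK.2 G hG F hFG)
  have := isPrime_degIdeal_one (k := k) Gᶜ
  exact Ideal.IsPrime.prod_mem_iff.2 ⟨i, hi, X_mem_degIdeal.2 (Finset.mem_compl.2 hiG)⟩

theorem mem_minimalPrimes_srIdeal (hK : IsComplex K) {P : Ideal (MvPolynomial V k)} :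
    P ∈ (srIdeal k K).minimalPrimes ↔ ∃ G, IsFacet K G ∧ P = degIdeal k Gᶜ 1 := by
  constructor
  · rintro ⟨⟨hP, hle⟩, hmin⟩
    obtain ⟨G, hG, hGP⟩ := exists_facet_degIdeal_le hP hle
    exact ⟨G, hG, le_antisymm
      (hmin ⟨isPrime_degIdeal_one _, srIdeal_le_degIdeal hK hG.1⟩ hGP) hGP⟩
  · rintro ⟨G, hG, rfl⟩
    refine ⟨⟨isPrime_degIdeal_one _, srIdeal_le_degIdeal hK hG.1⟩, fun P hP hPG => ?_⟩
    obtain ⟨G', hG', hle⟩ := exists_facet_degIdeal_le hP.1 hP.2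
    have hsub := Finset.compl_subset_compl.1 (subset_of_degIdeal_le (hle.trans hPG))
    rwa [hG.2 G' hG'.1 hsub] at hle

theorem symbPow_srIdeal_two (hK : IsComplex K) : symbPow (srIdeal k K) 2 = starIdeal k K ∅ := by
  have h : {J | ∃ P ∈ (srIdeal k K).minimalPrimes, J = P ^ 2} =
      Set.range fun t : {G // IsFacet K G ∧ ∅ ⊆ G} => degIdeal k t.1ᶜ 2 := by
    ext J
    simp [mem_minimalPrimes_srIdeal hK, degIdeal_eq_pow _ 2, eq_comm]
  rw [symbPow, h, sInf_range, starIdeal]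

theorem starIdeal_empty_le (F : Finset V) : starIdeal k K ∅ ≤ starIdeal k K F :=
  le_iInf fun t => iInf_le (fun t : {G // IsFacet K G ∧ ∅ ⊆ G} => degIdeal k t.1ᶜ 2)
    ⟨t.1, t.2.1, Finset.empty_subset _⟩

theorem prod_sq_mul_mem_starIdeal_empty {F : Finset V} {f : MvPolynomial V k}
    (hf : f ∈ starIdeal k K F) : (∏ i ∈ F, X i) ^ 2 * f ∈ starIdeal k K ∅ := by
  refine (Submodule.mem_iInf _).2 fun t => ?_
  by_cases hF : F ⊆ t.1
  · exact Ideal.mul_mem_left _ _ ((Submodule.mem_iInf _).1 hf ⟨t.1, t.2.1, hF⟩)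
  · obtain ⟨i, hi, hit⟩ := Finset.not_subset.1 hF
    have := isPrime_degIdeal_one (k := k) t.1ᶜ
    rw [degIdeal_eq_pow]
    exact Ideal.mul_mem_right _ _ (Ideal.pow_mem_pow (Ideal.IsPrime.prod_mem_iff.2
      ⟨i, hi, X_mem_degIdeal.2 (Finset.mem_compl.2 hit)⟩) 2)

theorem starIdeal_eq_degIdeal {G : Finset V} (hG : IsFacet K G) :
    starIdeal k K G = degIdeal k Gᶜ 2 := by
  refine le_antisymm (iInf_le (fun t : {H // IsFacet K H ∧ G ⊆ H} => degIdeal k t.1ᶜ 2)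
    ⟨G, hG, subset_rfl⟩) (le_iInf fun t => ?_)
  rw [hG.2 t.1 t.2.1.1 t.2.2]

theorem prod_sq_mem_annihilator {F : Finset V} {i : ℕ}
    (h : Subsingleton (ExtSelf (MvPolynomial V k) (MvPolynomial V k ⧸ starIdeal k K F) i)) :
    (∏ i ∈ F, X i) ^ 2 ∈ Module.annihilator (MvPolynomial V k)
      (ExtSelf (MvPolynomial V k) (MvPolynomial V k ⧸ starIdeal k K ∅) i) :=
  mem_annihilator_extSelf_of_smul_le (starIdeal_empty_le F)
    (fun _ hf => prod_sq_mul_mem_starIdeal_empty hf) h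

theorem annihilator_le_degIdeal_of_starIdeal {F : Finset V} {i : ℕ}
    (h : Module.annihilator (MvPolynomial V k)
      (ExtSelf (MvPolynomial V k) (MvPolynomial V k ⧸ starIdeal k K F) i) ≤ degIdeal k Fᶜ 1) :
    Module.annihilator (MvPolynomial V k)
      (ExtSelf (MvPolynomial V k) (MvPolynomial V k ⧸ starIdeal k K ∅) i) ≤ degIdeal k Fᶜ 1 := by
  intro a ha
  have hP := isPrime_degIdeal_one (k := k) Fᶜ
  refine (hP.mem_or_mem (h (mul_mem_annihilator_extSelf_of_smul_le (starIdeal_empty_le F)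
    (fun _ hf => prod_sq_mul_mem_starIdeal_empty hf) ha))).resolve_right fun hmem => ?_
  obtain ⟨j, hj, hjF⟩ := hP.prod_mem_iff.1 (hP.mem_of_pow_mem 2 hmem)
  exact Finset.mem_compl.1 (X_mem_degIdeal.1 hjF) hj

end SymbolicPower

section SerreDepth

variable {V : Type} [Fintype V] {k : Type} [Field k] {K : Set (Finset V)}

theorem card_facet_eq {d : ℕ} (hpure : Pure K) (hdim : HasDimCard K d) {G : Finset V}
    (hG : IsFacet K G) : G.card = d := by
  obtain ⟨⟨F, hF, rfl⟩, hle⟩ := hdim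
  obtain ⟨H, hH, hFH⟩ := exists_isFacet_superset hF
  exact (hpure G H hG hH).trans (le_antisymm (hle H hH.1) (Finset.card_le_card hFH))

theorem modDim_serreK_eq {J : Ideal (MvPolynomial V k)} {j : ℕ} (hj : j < Fintype.card V) :
    modDim (serreK k (quotMod k J) j) = ringKrullDim (MvPolynomial V k ⧸
      Module.annihilator (MvPolynomial V k)
        (ExtSelf (MvPolynomial V k) (MvPolynomial V k ⧸ J) (Fintype.card V - j))) := by
  obtain ⟨c, hc⟩ := Nat.exists_eq_add_of_lt hj
  have hc' : Fintype.card V - j = c + 1 := by omega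
  rw [modDim, serreK, Nat.card_eq_fintype_card, hc', quotMod, annihilator_extM_succ]

theorem modDim_serreK_eq_bot {J : Ideal (MvPolynomial V k)} {j : ℕ} (hj : j < Fintype.card V)
    (h : Subsingleton (ExtSelf (MvPolynomial V k) (MvPolynomial V k ⧸ J) (Fintype.card V - j))) :
    modDim (serreK k (quotMod k J) j) = ⊥ := by
  rw [modDim_serreK_eq hj]
  have := Ideal.Quotient.subsingleton_iff.2
    (Module.annihilator_eq_top_iff (R := MvPolynomial V k).2 h)
  exact ringKrullDim_eq_bot_of_subsingleton

variable [DecidableEq V]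

theorem le_modDim_serreK {J : Ideal (MvPolynomial V k)} {F : Finset V} {j : ℕ}
    (h : Module.annihilator (MvPolynomial V k)
      (ExtSelf (MvPolynomial V k) (MvPolynomial V k ⧸ J) (Fintype.card V - j)) ≤ degIdeal k Fᶜ 1) :
    (F.card : WithBot ℕ∞) ≤ modDim (serreK k (quotMod k J) j) := by
  rw [← Nat.card_eq_fintype_card] at h
  exact card_le_ringKrullDim_quotient ((annihilator_extM_le _ _).trans h)

theorem extSelf_starIdeal_subsingleton_of_diam {d s j : ℕ} (hK : IsComplex K) (hpure : Pure K)
    (hdim : HasDimCard K d) (hsd : s ≤ d)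
    (h : ∀ F ∈ K, (∃ G ∈ link K F, d - s + 2 ≤ G.card) → diamLE2 (link K F)) {F : Finset V}
    (hF : F.card + 1 = j) (hj : j < s) (hV : d ≤ Fintype.card V) :
    Subsingleton (ExtSelf (MvPolynomial V k) (MvPolynomial V k ⧸ starIdeal k K F)
      (Fintype.card V - j)) := by
  refine extSelf_starIdeal_subsingleton hK (fun hFK => h F hFK ?_) ?_ fun G hG _ => ?_
  · obtain ⟨H, hH, hFH⟩ := exists_isFacet_superset hFK
    refine ⟨H \ F, ⟨?_, Finset.sdiff_inter_self _ _⟩, ?_⟩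
    · rw [Finset.sdiff_union_of_subset hFH]
      exact hH.1
    · rw [Finset.card_sdiff_of_subset hFH, card_facet_eq hpure hdim hH]
      omega
  · rw [Finset.card_compl]
    omega
  · rw [card_facet_eq hpure hdim hG]
    omega

theorem extSelf_starIdeal_empty_card_subsingleton {d : ℕ} (hpure : Pure K)
    (hdim : HasDimCard K d) (hd : 0 < d) :
    Subsingleton (ExtSelf (MvPolynomial V k) (MvPolynomial V k ⧸ starIdeal k K ∅)
      (Fintype.card V)) := by
  have hL : ∀ t : {G // IsFacet K G ∧ ∅ ⊆ G}, IsMon t.1ᶜ (degIdeal k t.1ᶜ 2) :=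
    fun t => isMon_degIdeal _ _
  refine extSelf_subsingleton_iInf (C := Finset.univ) hL (fun t => Finset.subset_univ _)
    fun t => ?_
  have h1 := t.1.card_add_card_compl
  have h2 := card_facet_eq hpure hdim t.2.1
  rw [Finset.card_univ]
  omega

theorem le_serreDepth_starIdeal_iff {d s : ℕ} (hs : 2 ≤ s) (hsd : s ≤ d) (hK : IsComplex K)
    (hpure : Pure K) (hdim : HasDimCard K d) :
    s ≤ serreDepth k 2 (quotMod k (starIdeal k K ∅)) ↔
      ∀ F ∈ K, (∃ G ∈ link K F, d - s + 2 ≤ G.card) → diamLE2 (link K F) := by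
  have hV : d ≤ Fintype.card V := by
    obtain ⟨⟨F, -, rfl⟩, -⟩ := hdim
    exact Finset.card_le_univ F
  constructor
  · rintro hle F hF ⟨G, hG, hGcard⟩
    by_contra hdiam
    have hcard : G.card + F.card ≤ d := by
      rw [← Finset.card_union_of_disjoint (Finset.disjoint_iff_inter_eq_empty.2 hG.2)]
      exact hdim.2 _ hG.1
    have hmem : F.card + 1 ∈ {j : ℕ | ((j + 1 - 2 : ℕ) : WithBot ℕ∞) ≤
        modDim (serreK k (quotMod k (starIdeal k K ∅)) j)} :=
      le_modDim_serreK (annihilator_le_degIdeal_of_starIdeal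
        (annihilator_extSelf_starIdeal_le hK (by rw [Finset.card_compl]; omega) hdiam))
    have := hle.trans (Nat.sInf_le hmem)
    omega
  · intro h
    have hne : {j : ℕ | ((j + 1 - 2 : ℕ) : WithBot ℕ∞) ≤
        modDim (serreK k (quotMod k (starIdeal k K ∅)) j)}.Nonempty := by
      obtain ⟨F, hF⟩ := hK.1
      obtain ⟨G, hG, -⟩ := exists_isFacet_superset hF
      refine ⟨G.card, le_trans ?_ (le_modDim_serreK (F := G)
        (annihilator_le_degIdeal_of_starIdeal ?_))⟩
      · exact_mod_cast show G.card + 1 - 2 ≤ G.card by omega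
      · rw [starIdeal_eq_degIdeal hG, ← Finset.card_compl]
        exact annihilator_extSelf_degIdeal_two_le _
    by_contra! hlt
    have hj : serreDepth k 2 (quotMod k (starIdeal k K ∅)) ∈ _ := Nat.sInf_mem hne
    generalize serreDepth k 2 (quotMod k (starIdeal k K ∅)) = j at hlt hj
    have hjV : j < Fintype.card V := by omega
    rw [Set.mem_ofPred_eq] at hj
    match j with
    | 0 =>
      rw [modDim_serreK_eq_bot hjV
        (extSelf_starIdeal_empty_card_subsingleton hpure hdim (by omega))] at hj
      simp at hj
    | 1 =>
      rw [modDim_serreK_eq_bot hjV (extSelf_starIdeal_subsingleton_of_diam hK hpure hdim hsd h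
        (F := ∅) rfl hlt hV)] at hj
      simp at hj
    | q + 2 =>
      rw [modDim_serreK_eq hjV] at hj
      have := hj.trans (ringKrullDim_quotient_le_of_prod_mem (q := q) fun F hF =>
        prod_sq_mem_annihilator (extSelf_starIdeal_subsingleton_of_diam hK hpure hdim hsd h
          (by rw [hF]) hlt hV))
      have : q + 2 + 1 - 2 ≤ q := by exact_mod_cast this
      omega

end SerreDepth

/-- Theorem `S2depth`: for a pure simplicial complex `Δ` with
`dim Δ = d - 1` and `2 ≤ s ≤ d`: `S_2-depth(S/I_Δ^(2)) ≥ s` iff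
`diam((link_Δ F)^(1)) ≤ 2` for every face `F ∈ Δ` with `dim link_Δ F ≥ d - s + 1`. -/
theorem serreDepth_symbPow_two_ge_iff_diam_links
    (k : Type) [Field k] (n d s : ℕ) (hs : 2 ≤ s) (hsd : s ≤ d)
    (K : Set (Finset (Fin n))) (hK : IsComplex K) (hpure : Pure K)
    (hdim : HasDimCard K d) :
    s ≤ serreDepth k 2 (quotMod k (symbPow (srIdeal k K) 2)) ↔
      ∀ F ∈ K, (∃ G ∈ link K F, d - s + 2 ≤ G.card) → diamLE2 (link K F) := by
  rw [symbPow_srIdeal_two hK]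
  exact le_serreDepth_starIdeal_iff hs hsd hK hpure hdim

end SerrePaper
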